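/- arXiv:1906.07881 — 3 statements merged into one kernel-verified Lean document; each statement's English description precedes it below -/
import Mathlib

section
/- (Negativity of eigenvalues of the linearized operator for c>c*.) Assume (H1), (EXP) and (H2), and suppose c > c*, where c* := inf_{μ>0} (∫_ℝ e^{−μ z} k(z) dz − 1 + r)/μ. If λ∈ℝ and φ:ℝ→(0,∞) is a bounded C¹ function satisfying c φ'(ξ)+∫_ℝ k(η−ξ) φ(η) dη − φ(ξ) + f(ξ,0) φ(ξ) = λ φ(ξ) for all ξ∈ℝ, then λ < 0. -/
open MeasureTheory Real Set Filter Topology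

noncomputable section

/-- Hypothesis (H1) on the kernel `k`. -/
def H1 (k : ℝ → ℝ) : Prop :=
  ContDiff ℝ 1 k ∧ (∀ z, 0 ≤ k z) ∧ (∀ z, k (-z) = k z) ∧
  (∫ z, k z) = 1 ∧ 0 < k 0 ∧
  ∃ μ M : ℝ, 0 < μ ∧ 0 < M ∧ ∀ z, M < |z| →
    k z < Real.exp (-(μ * |z|)) ∧ |deriv k z| < Real.exp (-(μ * |z|))

/-- Hypothesis (EXP): all exponential moments of `k` are finite. -/
def EXPk (k : ℝ → ℝ) : Prop :=
  ∀ μ : ℝ, MeasureTheory.Integrable (fun z => Real.exp (μ * z) * k z)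

/-- Hypothesis (H2) on the cut-off function `χ`. -/
def IsH2chi (r q L L0 : ℝ) (χ : ℝ → ℝ) : Prop :=
  0 < r ∧ 0 < q ∧ 0 < L ∧ 0 < L0 ∧
  ContDiff ℝ 1 χ ∧ (∀ x, χ x ∈ Set.Icc (0:ℝ) 1) ∧
  (∀ x, χ (-x) = χ x) ∧ (∀ x, |x| ≤ L → χ x = 1) ∧
  (∀ x, L + L0 ≤ |x| → χ x = 0) ∧ AntitoneOn χ (Set.Ici 0)

/-- The growth function of hypothesis (H2). -/
def fH2 (r q : ℝ) (χ : ℝ → ℝ) : ℝ → ℝ → ℝ :=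
  fun x u => -q + (r * (1 - u) + q) * χ x

/-- A bounded positive traveling-wave profile for speed `c`, kernel `k`, growth `f`. -/
def IsTW (c : ℝ) (k : ℝ → ℝ) (f : ℝ → ℝ → ℝ) (Φ : ℝ → ℝ) : Prop :=
  ContDiff ℝ 1 Φ ∧ (∀ ξ, 0 < Φ ξ) ∧ (∃ C, ∀ ξ, Φ ξ ≤ C) ∧
  ∀ ξ, c * deriv Φ ξ + ((∫ η, k (η - ξ) * Φ η) - Φ ξ) + f ξ (Φ ξ) * Φ ξ = 0

/-- A bounded classical solution of equation (E) on `[0,∞) × ℝ`, with partial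
derivatives `vt` (in time) and `vx` (in space). -/
def IsClassicalSol (c : ℝ) (k : ℝ → ℝ) (f : ℝ → ℝ → ℝ) (v vt vx : ℝ → ℝ → ℝ) : Prop :=
  (∃ C, ∀ t ξ, 0 ≤ t → |v t ξ| ≤ C) ∧
  ContinuousOn (fun p : ℝ × ℝ => v p.1 p.2) {p : ℝ × ℝ | 0 ≤ p.1} ∧
  ContinuousOn (fun p : ℝ × ℝ => vt p.1 p.2) {p : ℝ × ℝ | 0 ≤ p.1} ∧
  ContinuousOn (fun p : ℝ × ℝ => vx p.1 p.2) {p : ℝ × ℝ | 0 ≤ p.1} ∧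
  (∀ t ξ, 0 ≤ t → HasDerivWithinAt (fun s => v s ξ) (vt t ξ) (Set.Ici 0) t) ∧
  (∀ t ξ, 0 ≤ t → HasDerivAt (fun y => v t y) (vx t ξ) ξ) ∧
  (∀ t ξ, 0 ≤ t →
    vt t ξ = c * vx t ξ + ((∫ η, k (η - ξ) * v t η) - v t ξ) + f ξ (v t ξ) * v t ξ)

/-- The spreading speed `c*` of the homogeneous equation with growth rate `r`. -/
def cstar (k : ℝ → ℝ) (r : ℝ) : ℝ :=
  sInf {y : ℝ | ∃ μ : ℝ, 0 < μ ∧ y = ((∫ z, Real.exp (-(μ * z)) * k z) - 1 + r) / μ}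

lemma aux_int (k : ℝ → ℝ) (hexp : EXPk k) (a ξ : ℝ) :
    Integrable (fun η => k (η - ξ) * Real.exp (a * η)) ∧
    ∫ η, k (η - ξ) * Real.exp (a * η) = Real.exp (a * ξ) * ∫ z, Real.exp (a * z) * k z := by
  have h : (fun η => k (η - ξ) * Real.exp (a * η)) =
      fun η => Real.exp (a * ξ) * (fun z => Real.exp (a * z) * k z) (η - ξ) := by
    funext η
    have : Real.exp (a * η) = Real.exp (a * ξ) * Real.exp (a * (η - ξ)) := by
      rw [← Real.exp_add]; congr 1; ring
    simp only [this]; ring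
  rw [h]
  refine ⟨((hexp a).comp_sub_right ξ).const_mul _, ?_⟩
  rw [integral_const_mul, integral_sub_right_eq_self (fun z => Real.exp (a * z) * k z) ξ]

lemma aux_nu (k : ℝ → ℝ) (hk : H1 k) (hexp : EXPk k) (c q : ℝ) (hq : 0 < q) :
    ∃ ν : ℝ, 0 < ν ∧ c * ν + (∫ z, Real.exp (ν * z) * k z) - 1 < q := by
  obtain ⟨-, hk0, -, hk1, -⟩ := hk
  have hki : Integrable k := by simpa using hexp 0
  set M1 := ∫ z, Real.exp (1 * z) * k z with hM1
  set D := c + M1 - 1 with hD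
  have hden : 0 < 2 * (|D| + 1) := by positivity
  refine ⟨min 1 (q / (2 * (|D| + 1))), by positivity, ?_⟩
  set ν := min 1 (q / (2 * (|D| + 1))) with hν
  have hνpos : 0 < ν := by positivity
  have hν1 : ν ≤ 1 := min_le_left _ _
  have hν2 : ν * (2 * (|D| + 1)) ≤ q := by
    rw [← le_div_iff₀ hden]; exact min_le_right _ _
  have hM : (∫ z, Real.exp (ν * z) * k z) ≤ (1 - ν) * (∫ z, k z) + ν * M1 := by
    rw [hM1, ← integral_const_mul, ← integral_const_mul,
      ← integral_add (hki.const_mul _) ((hexp 1).const_mul _)]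
    refine integral_mono (hexp ν) ((hki.const_mul _).add ((hexp 1).const_mul _)) ?_
    intro z
    have hc := convexOn_exp.2 (Set.mem_univ (0:ℝ)) (Set.mem_univ z)
      (sub_nonneg.2 hν1) hνpos.le (by ring)
    simp only [smul_eq_mul, mul_zero, zero_add, Real.exp_zero, mul_one] at hc
    have := mul_le_mul_of_nonneg_right hc (hk0 z)
    simp only [one_mul]
    linarith
  rw [hk1] at hM
  have h3 : ν * D ≤ ν * |D| := mul_le_mul_of_nonneg_left (le_abs_self D) hνpos.le
  have h4 : 0 ≤ ν * |D| := by positivity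
  have h5 : ν * D = c * ν + ν * M1 - ν := by rw [hD]; ring
  nlinarith

set_option maxHeartbeats 1000000 in
/-- Negativity of eigenvalues of the linearized operator for `c > c*`. -/
theorem eigenvalue_negative_of_c_gt_cstar
    (k : ℝ → ℝ) (hk : H1 k) (hexp : EXPk k)
    (r q L L0 : ℝ) (χ : ℝ → ℝ) (hχ : IsH2chi r q L L0 χ)
    (c : ℝ) (hc : cstar k r < c)
    (lam : ℝ) (φ : ℝ → ℝ)
    (hφC : ContDiff ℝ 1 φ) (hφpos : ∀ ξ, 0 < φ ξ) (hφbd : ∃ C, ∀ ξ, φ ξ ≤ C)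
    (heig : ∀ ξ,
      c * deriv φ ξ + ((∫ η, k (η - ξ) * φ η) - φ ξ) + fH2 r q χ ξ 0 * φ ξ = lam * φ ξ) :
    lam < 0 := by
  by_contra hlam
  push Not at hlam
  obtain ⟨hr, hq, hL, hL0, hχC, hχ01, -, -, hχ0, -⟩ := hχ
  obtain ⟨C, hC⟩ := hφbd
  have hk0 := hk.2.1
  have hki : Integrable k := by simpa using hexp 0
  have hne : {y : ℝ | ∃ μ : ℝ, 0 < μ ∧
      y = ((∫ z, Real.exp (-(μ * z)) * k z) - 1 + r) / μ}.Nonempty := ⟨_, 1, one_pos, rfl⟩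
  obtain ⟨y, ⟨μ, hμ, rfl⟩, hy⟩ := exists_lt_of_csInf_lt hne hc
  rw [div_lt_iff₀ hμ] at hy
  obtain ⟨ν, hν, hN⟩ := aux_nu k hk hexp c q hq
  set Mm := ∫ z, Real.exp (-μ * z) * k z with hMm
  have hMm' : (∫ z, Real.exp (-(μ * z)) * k z) = Mm := by simp [hMm]
  rw [hMm'] at hy
  set Mn := ∫ z, Real.exp (ν * z) * k z with hMn
  set A := L + L0 with hA
  set δ := c * μ - (Mm - 1 + r) with hδ
  have hδpos : 0 < δ := by rw [hδ]; linarith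
  obtain ⟨ε, hε, hεs⟩ : ∃ ε : ℝ, 0 < ε ∧
      ε * (Real.exp (ν * A) * (q + r)) < δ * Real.exp (-μ * A) := by
    refine ⟨δ * Real.exp (-μ * A) / (2 * (Real.exp (ν * A) * (q + r))), by positivity, ?_⟩
    have h1 : 0 < Real.exp (ν * A) * (q + r) := by positivity
    have h2 : 0 < δ * Real.exp (-μ * A) := by positivity
    rw [div_mul_eq_mul_div, div_lt_iff₀ (by positivity)]
    nlinarith [mul_pos h1 h2]
  set w : ℝ → ℝ := fun ξ => Real.exp (-μ * ξ) + ε * Real.exp (ν * ξ) with hw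
  have hwpos : ∀ ξ, 0 < w ξ := fun ξ => by simp only [hw]; positivity
  have hwc : Continuous w := by simp only [hw]; fun_prop
  have hφc : Continuous φ := hφC.continuous
  have hwtop : Tendsto w (cocompact ℝ) atTop := by
    rw [cocompact_eq_atBot_atTop, tendsto_sup]
    constructor
    · refine tendsto_atTop_mono (f := fun ξ => Real.exp (-μ * ξ)) ?_ ?_
      · intro ξ; simp only [hw]; have : 0 < ε * Real.exp (ν * ξ) := by positivity
        linarith
      · exact Real.tendsto_exp_atTop.comp
          (tendsto_id.const_mul_atBot_of_neg (neg_lt_zero.2 hμ))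
    · refine tendsto_atTop_mono (f := fun ξ => ε * Real.exp (ν * ξ)) ?_ ?_
      · intro ξ; simp only [hw]; have : 0 < Real.exp (-μ * ξ) := by positivity
        linarith
      · exact (Real.tendsto_exp_atTop.comp (tendsto_id.const_mul_atTop hν)).const_mul_atTop hε
  have hg : Continuous fun ξ => φ ξ / w ξ := hφc.div hwc fun ξ => (hwpos ξ).ne'
  obtain ⟨ξ0, hmax⟩ := hg.exists_forall_ge' 0 (by
    have hg0 : 0 < φ 0 / w 0 := div_pos (hφpos 0) (hwpos 0)
    filter_upwards [hwtop.eventually_ge_atTop (C / (φ 0 / w 0))] with ξ hξ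
    rw [div_le_iff₀ (hwpos ξ)]
    rw [div_le_iff₀ hg0] at hξ
    linarith [hC ξ])
  set m := φ ξ0 / w ξ0 with hm
  have hmpos : 0 < m := div_pos (hφpos _) (hwpos _)
  have hle : ∀ ξ, φ ξ ≤ m * w ξ := fun ξ => by
    rw [← div_le_iff₀ (hwpos ξ)]; exact hmax ξ
  have heq : φ ξ0 = m * w ξ0 := by rw [hm]; field_simp [(hwpos ξ0).ne']
  have hwd : HasDerivAt w (-μ * Real.exp (-μ * ξ0) + ε * (ν * Real.exp (ν * ξ0))) ξ0 := by
    have e : ∀ a : ℝ, HasDerivAt (fun ξ => Real.exp (a * ξ)) (a * Real.exp (a * ξ0)) ξ0 := by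
      intro a
      have := ((hasDerivAt_id ξ0).const_mul a).exp
      simpa [mul_comm] using this
    exact (e (-μ)).add ((e ν).const_mul ε)
  have hφd : HasDerivAt φ (deriv φ ξ0) ξ0 :=
    (hφC.differentiable (by norm_num) ξ0).hasDerivAt
  have hd0 : deriv φ ξ0 - m * (-μ * Real.exp (-μ * ξ0) + ε * (ν * Real.exp (ν * ξ0))) = 0 := by
    have hl : IsLocalMax (fun ξ => φ ξ - m * w ξ) ξ0 :=
      Filter.Eventually.of_forall fun ξ => by
        show φ ξ - m * w ξ ≤ φ ξ0 - m * w ξ0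
        linarith [hle ξ]
    exact hl.hasDerivAt_eq_zero (hφd.sub (hwd.const_mul m))
  obtain ⟨i1, v1⟩ := aux_int k hexp (-μ) ξ0
  obtain ⟨i2, v2⟩ := aux_int k hexp ν ξ0
  have hK : (∫ η, k (η - ξ0) * φ η) ≤
      m * (Real.exp (-μ * ξ0) * Mm + ε * (Real.exp (ν * ξ0) * Mn)) := by
    rw [hMm, hMn, ← v1, ← v2, ← integral_const_mul, ← integral_add i1 (i2.const_mul ε),
      ← integral_const_mul]
    refine integral_mono ?_ ((i1.add (i2.const_mul ε)).const_mul m) ?_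
    · refine (hki.comp_sub_right ξ0).mul_bdd (c := C) hφc.aestronglyMeasurable ?_
      refine Filter.Eventually.of_forall fun ξ => ?_
      rw [Real.norm_eq_abs, abs_of_pos (hφpos ξ)]; exact hC ξ
    · intro η
      have := mul_le_mul_of_nonneg_left (hle η) (hk0 (η - ξ0))
      simp only [hw] at this ⊢
      linarith
  have he := heig ξ0
  set F := fH2 r q χ ξ0 0 with hF
  have hFe : F = -q + (r + q) * χ ξ0 := by simp [hF, fH2]
  have hlφ : 0 ≤ lam * φ ξ0 := mul_nonneg hlam (hφpos _).le
  set a := Real.exp (-μ * ξ0) with ha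
  set b := Real.exp (ν * ξ0) with hb
  have hapos : 0 < a := Real.exp_pos _
  have hbpos : 0 < b := Real.exp_pos _
  have hw0 : w ξ0 = a + ε * b := rfl
  have hd1 : deriv φ ξ0 = m * (-μ * a + ε * (ν * b)) := by linarith
  rw [hd1, heq, hw0] at he
  rw [heq, hw0] at hlφ
  have hfin : 0 ≤ m * (a * (-(c * μ) + Mm - 1 + F) + ε * b * (c * ν + Mn - 1 + F)) := by
    linarith
  have hfin2 := nonneg_of_mul_nonneg_right hfin hmpos
  rcases le_or_gt A ξ0 with h | h
  · have hF' : F = -q := by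
      rw [hFe, hχ0 ξ0 (h.trans (le_abs_self _))]; ring
    have t1 : a * (-(c * μ) + Mm - 1 + F) < 0 := mul_neg_of_pos_of_neg hapos (by linarith)
    have t2 : ε * b * (c * ν + Mn - 1 + F) < 0 :=
      mul_neg_of_pos_of_neg (by positivity) (by linarith)
    linarith
  · have hF' : F ≤ r := by
      have := (hχ01 ξ0).2
      rw [hFe]; nlinarith
    have t1 : a * (-(c * μ) + Mm - 1 + F) ≤ a * (-δ) :=
      mul_le_mul_of_nonneg_left (by rw [hδ]; linarith) hapos.le
    have t2 : ε * b * (c * ν + Mn - 1 + F) ≤ ε * b * (q + r) :=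
      mul_le_mul_of_nonneg_left (by linarith) (by positivity)
    have t3 : Real.exp (-μ * A) ≤ a :=
      Real.exp_le_exp.2 (mul_le_mul_of_nonpos_left h.le (neg_nonpos.2 hμ.le))
    have t4 : b ≤ Real.exp (ν * A) :=
      Real.exp_le_exp.2 (mul_le_mul_of_nonneg_left h.le hν.le)
    have t5 : δ * Real.exp (-μ * A) ≤ δ * a := mul_le_mul_of_nonneg_left t3 hδpos.le
    have t6 : ε * (b * (q + r)) ≤ ε * (Real.exp (ν * A) * (q + r)) := by gcongr
    linarith
end
end

section
/- (Properties of the spectral radius ρ(α) of the composed operator.) Assume (H1). Let c>0, p>0, let a:ℝ→ℝ be continuous with a(ξ+p)=a(ξ) for all ξ, and set ā = (1/p)∫₀^p a(s) ds. Let X_p be the Banach space of continuous p-periodic functions ℝ→ℝ with the supremum norm. For each α > −1 + ā, define the bounded linear operator A_α on X_p by (A_α w)(ξ) = ∫_ℝ k(η−ξ) [ (1/c) ∫_η^∞ exp((1/c)∫_ζ^η (α+1−a(s)) ds) w(ζ) dζ ] dη, and let ρ(α) be the spectral radius of A_α. Then: (i) ρ(α₁) > ρ(α₂) whenever −1+ā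 < α₁ < α₂; (ii) ρ(α) → 0 as α → ∞; (iii) ρ is continuous on (−1+ā, ∞). -/
open MeasureTheory Real Set Filter Topology

noncomputable section

section Abstract

variable {E : Type*} [NormedAddCommGroup E] [NormedSpace ℝ E] {K : Type*}

/-- Evaluation functionals turning `E` into an order unit space with unit `e`. -/
structure UnitSp (ev : K → E →L[ℝ] ℝ) (e : E) : Prop where
  ne : Nonempty K
  one : ∀ x, ev x e = 1
  bd : ∀ w x, |ev x w| ≤ ‖w‖
  le : ∀ w C, 0 ≤ C → (∀ x, |ev x w| ≤ C) → ‖w‖ ≤ C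

/-- Positive operators. -/
def PosOp (ev : K → E →L[ℝ] ℝ) (T : E →L[ℝ] E) : Prop :=
  ∀ w : E, (∀ x, 0 ≤ ev x w) → ∀ x, 0 ≤ ev x (T w)

variable {ev : K → E →L[ℝ] ℝ} {e : E}

theorem posOp_closed : IsClosed {T : E →L[ℝ] E | PosOp ev T} := by
  have : {T : E →L[ℝ] E | PosOp ev T} =
      ⋂ (w : E) (_ : ∀ x, 0 ≤ ev x w) (x : K), {T : E →L[ℝ] E | 0 ≤ ev x (T w)} := by
    ext T; simp [PosOp]
  rw [this]
  refine isClosed_iInter fun w => isClosed_iInter fun _ => isClosed_iInter fun x => ?_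
  refine isClosed_le continuous_const ?_
  exact (ev x).continuous.comp (ContinuousLinearMap.apply ℝ E w).continuous

theorem posOp_mul {S T : E →L[ℝ] E} (hS : PosOp ev S) (hT : PosOp ev T) :
    PosOp ev (S * T) := fun w hw => hS _ (hT w hw)

theorem posOp_smul {T : E →L[ℝ] E} {s : ℝ} (hs : 0 ≤ s) (hT : PosOp ev T) :
    PosOp ev (s • T) := fun w hw x => by
  simpa using mul_nonneg hs (hT w hw x)

theorem posOp_pow {T : E →L[ℝ] E} (hT : PosOp ev T) (n : ℕ) : PosOp ev (T ^ n) := by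
  induction n with
  | zero => intro w hw x; simpa using hw x
  | succ n ih => rw [pow_succ]; exact posOp_mul ih hT

theorem posOp_tsum {T : E →L[ℝ] E} (hT : PosOp ev T) (h : Summable fun n : ℕ => T ^ n) :
    PosOp ev (∑' n : ℕ, T ^ n) := by
  refine posOp_closed.mem_of_tendsto h.hasSum (Eventually.of_forall fun s => ?_)
  intro w hw x
  have : ev x ((∑ n ∈ s, T ^ n) w) = ∑ n ∈ s, ev x ((T ^ n) w) := by
    rw [sum_apply, map_sum]
  rw [this]
  exact Finset.sum_nonneg fun n _ => posOp_pow hT n w hw x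

theorem posOp_mono {T : E →L[ℝ] E} (hT : PosOp ev T) {u v : E}
    (h : ∀ x, ev x u ≤ ev x v) (x : K) : ev x (T u) ≤ ev x (T v) := by
  have := hT (v - u) (fun x => by simpa using h x) x
  simpa using this

theorem posOp_norm (hE : UnitSp ev e) {T : E →L[ℝ] E} (hT : PosOp ev T) {C : ℝ} (hC : 0 ≤ C)
    (h : ∀ x, ev x (T e) ≤ C) : ‖T‖ ≤ C := by
  refine ContinuousLinearMap.opNorm_le_bound _ hC fun w => ?_
  refine hE.le _ _ (by positivity) ?_
  intro x
  have h1 : ev x (T w) ≤ ev x (T (‖w‖ • e)) := posOp_mono hT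
    (fun y => by simpa [hE.one] using (le_abs_self _).trans (hE.bd w y)) x
  have h2 : ev x (T (-(‖w‖ • e))) ≤ ev x (T w) := posOp_mono hT
    (fun y => by simpa [hE.one] using neg_le_of_abs_le (hE.bd w y)) x
  have h3 : ‖w‖ * ev x (T e) ≤ ‖w‖ * C := mul_le_mul_of_nonneg_left (h x) (norm_nonneg _)
  simp only [map_neg, map_smul, smul_eq_mul] at h1 h2
  rw [abs_le]
  constructor <;> linarith

theorem ev_pow_le (hE : UnitSp ev e) (T : E →L[ℝ] E) (x : K) : ev x (T e) ≤ ‖T‖ := by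
  have h1 : ‖e‖ ≤ 1 := hE.le _ _ zero_le_one fun x => by simp [hE.one]
  calc ev x (T e) ≤ ‖T e‖ := (le_abs_self _).trans (hE.bd _ x)
    _ ≤ ‖T‖ * ‖e‖ := T.le_opNorm e
    _ ≤ ‖T‖ * 1 := mul_le_mul_of_nonneg_left h1 (norm_nonneg _)
    _ = ‖T‖ := mul_one _

/-- real valued spectral radius -/
def sr (T : E →L[ℝ] E) : ℝ := (spectralRadius ℝ T).toReal

theorem sr_nonneg (T : E →L[ℝ] E) : 0 ≤ sr T := ENNReal.toReal_nonneg

theorem sr_le {T : E →L[ℝ] E} {m : ℝ} (hm : 0 ≤ m)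
    (h : ∀ l ∈ spectrum ℝ T, |l| ≤ m) : sr T ≤ m := by
  refine ENNReal.toReal_le_of_le_ofReal hm ?_
  refine iSup₂_le fun l hl => ?_
  rw [← ENNReal.ofReal_coe_nnreal]
  exact ENNReal.ofReal_le_ofReal (by simpa using h l hl)

theorem le_of_pow_bound {x y C : ℝ} (hy : 0 < y) (h : ∀ n : ℕ, x ^ n ≤ C * y ^ n) :
    x ≤ y := by
  by_contra hxy
  push Not at hxy
  have h1 : 1 < x / y := by rwa [one_lt_div hy]
  obtain ⟨n, hn⟩ := pow_unbounded_of_one_lt C h1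
  have := h n
  rw [div_pow, lt_div_iff₀ (by positivity)] at hn
  linarith

variable [CompleteSpace E] [Nontrivial E]

theorem spec_ne_top (T : E →L[ℝ] E) : spectralRadius ℝ T ≠ ⊤ :=
  ne_top_of_le_ne_top ENNReal.coe_ne_top (spectrum.spectralRadius_le_nnnorm T)

theorem le_sr {T : E →L[ℝ] E} {l : ℝ} (h : l ∈ spectrum ℝ T) : |l| ≤ sr T := by
  have h1 : (‖l‖₊ : ENNReal) ≤ spectralRadius ℝ T :=
    le_iSup₂ (f := fun (k : ℝ) (_ : k ∈ spectrum ℝ T) => (‖k‖₊ : ENNReal)) l h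
  have := ENNReal.toReal_mono (spec_ne_top T) h1
  simpa [sr] using this

theorem sr_le_of_bound (hE : UnitSp ev e) {T : E →L[ℝ] E} (hT : PosOp ev T) {m C : ℝ} (hm : 0 < m)
    (h : ∀ n : ℕ, ∀ x, ev x ((T ^ n) e) ≤ C * m ^ n) : sr T ≤ m := by
  refine sr_le hm.le fun l hl => ?_
  have hC : 0 ≤ C := by
    have := h 0 hE.ne.some
    simp [hE.one] at this; linarith
  refine le_of_pow_bound (C := C) hm fun n => ?_
  have h1 := spectrum.norm_le_norm_of_mem (spectrum.pow_mem_pow T n hl)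
  have h2 := posOp_norm hE (posOp_pow hT n) (by positivity) (h n)
  rw [norm_pow, Real.norm_eq_abs] at h1
  linarith

theorem inv_pos_aux {T : E →L[ℝ] E} (hT : PosOp ev T) {l μ C : ℝ} (hμ0 : 0 < μ) (hμl : μ < l)
    (hC : ∀ n : ℕ, ‖T ^ n‖ ≤ C * μ ^ n) :
    PosOp ev (Ring.inverse (algebraMap ℝ (E →L[ℝ] E) l - T)) := by
  have hl0 : 0 < l := hμ0.trans hμl
  have hsum : Summable fun n : ℕ => (l⁻¹ • T) ^ n := by
    refine Summable.of_norm_bounded (g := fun n : ℕ => C * (μ / l) ^ n) ?_ fun n => ?_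
    · exact (summable_geometric_of_lt_one (by positivity) ((div_lt_one hl0).2 hμl)).mul_left C
    · rw [smul_pow, norm_smul, norm_pow, norm_inv, Real.norm_of_nonneg hl0.le, div_pow]
      calc l⁻¹ ^ n * ‖T ^ n‖ ≤ l⁻¹ ^ n * (C * μ ^ n) := by
            gcongr; exact hC n
        _ = C * (μ ^ n / l ^ n) := by rw [inv_pow]; ring
  have e1 : algebraMap ℝ (E →L[ℝ] E) l - T = l • (1 - l⁻¹ • T) := by
    rw [smul_sub, smul_smul, mul_inv_cancel₀ hl0.ne', one_smul, Algebra.algebraMap_eq_smul_one]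
  have e2 : Ring.inverse (algebraMap ℝ (E →L[ℝ] E) l - T) =
      l⁻¹ • ∑' n : ℕ, (l⁻¹ • T) ^ n := by
    have h1 : (algebraMap ℝ (E →L[ℝ] E) l - T) * (l⁻¹ • ∑' n : ℕ, (l⁻¹ • T) ^ n) = 1 := by
      rw [e1, smul_mul_smul_comm, mul_inv_cancel₀ hl0.ne', one_smul, hsum.one_sub_mul_tsum_pow]
    have h2 : (l⁻¹ • ∑' n : ℕ, (l⁻¹ • T) ^ n) * (algebraMap ℝ (E →L[ℝ] E) l - T) = 1 := by
      rw [e1, smul_mul_smul_comm, inv_mul_cancel₀ hl0.ne', one_smul, hsum.tsum_pow_mul_one_sub]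
    exact Ring.inverse_unit (⟨_, _, h1, h2⟩ : (E →L[ℝ] E)ˣ)
  rw [e2]
  exact posOp_smul (by positivity) (posOp_tsum (posOp_smul (by positivity) hT) hsum)

theorem bound_aux (hE : UnitSp ev e) {T R : E →L[ℝ] E} (hT : PosOp ev T) {ν : ℝ}
    (hν0 : 0 < ν) (hRpos : PosOp ev R)
    (huR : (algebraMap ℝ (E →L[ℝ] E) ν - T) * R = 1) :
    ∃ μ, 0 < μ ∧ μ < ν ∧ ∃ C : ℝ, ∀ n : ℕ, ‖T ^ n‖ ≤ C * μ ^ n := by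
  set δ : ℝ := min (ν / 2) (1 / (2 * (‖R‖ + 1))) with hδ
  have hRn := norm_nonneg R
  have hδ0 : 0 < δ := lt_min (by positivity) (by positivity)
  have hδ1 : δ * ‖R‖ < 1 := by
    calc δ * ‖R‖ ≤ 1 / (2 * (‖R‖ + 1)) * ‖R‖ := by gcongr; exact min_le_right _ _
      _ < 1 := by
        rw [div_mul_eq_mul_div, div_lt_one (by positivity)]; linarith
  have hδν : δ ≤ ν / 2 := min_le_left _ _
  have hsum : Summable fun n : ℕ => (δ • R) ^ n := by
    apply summable_geometric_of_norm_lt_one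
    rw [norm_smul, Real.norm_of_nonneg hδ0.le]; exact hδ1
  set S : E →L[ℝ] E := R * ∑' n : ℕ, (δ • R) ^ n with hS
  have hSpos : PosOp ev S := posOp_mul hRpos (posOp_tsum (posOp_smul hδ0.le hRpos) hsum)
  have hS1 : (algebraMap ℝ (E →L[ℝ] E) (ν - δ) - T) * S = 1 := by
    have h1 := hsum.one_sub_mul_tsum_pow
    have h2 : (algebraMap ℝ (E →L[ℝ] E) (ν - δ) - T) * R = 1 - δ • R := by
      rw [map_sub, sub_right_comm, sub_mul, huR, Algebra.algebraMap_eq_smul_one δ, smul_mul_assoc,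
        one_mul]
    rw [hS, ← mul_assoc, h2, h1]
  set μ := ν - δ with hμ
  have hμ0 : 0 < μ := by linarith
  set f : E := S e with hf
  have hf0 : ∀ x, 0 ≤ ev x f := hSpos e (fun x => by simp [hE.one])
  have hfe : ∀ x, μ * ev x f = 1 + ev x (T f) := by
    intro x
    have h1 := congrArg (fun Q : E →L[ℝ] E => ev x (Q e)) hS1
    have h2 : ev x (((algebraMap ℝ (E →L[ℝ] E) μ - T) * S) e) = μ * ev x f - ev x (T f) := by
      rw [Algebra.algebraMap_eq_smul_one]
      simp [hf]
    simp only [h2] at h1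
    rw [one_apply_eq_self, hE.one] at h1
    linarith
  have hTf := hT f hf0
  have key : ∀ n : ℕ, ∀ x, ev x ((T ^ n) e) ≤ μ ^ (n + 1) * ev x f := by
    intro n
    induction n with
    | zero => intro x; have := hfe x; have := hTf x; simp [hE.one]; linarith
    | succ n ih =>
      intro x
      have h1 : ev x (T ((T ^ n) e)) ≤ ev x (T (μ ^ (n + 1) • f)) :=
        posOp_mono hT (fun y => by simpa using ih y) x
      have h2 : ev x ((T ^ (n + 1)) e) = ev x (T ((T ^ n) e)) := by rw [pow_succ']; rfl
      rw [h2]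
      refine h1.trans ?_
      simp only [map_smul, smul_eq_mul]
      have h3 : ev x (T f) ≤ μ * ev x f := by rw [hfe]; linarith
      calc μ ^ (n + 1) * ev x (T f) ≤ μ ^ (n + 1) * (μ * ev x f) := by gcongr
        _ = _ := by ring
  refine ⟨μ, hμ0, by linarith, μ * ‖f‖, fun n => ?_⟩
  refine posOp_norm hE (posOp_pow hT n) (by positivity) fun x => (key n x).trans ?_
  calc μ ^ (n + 1) * ev x f ≤ μ ^ (n + 1) * ‖f‖ := by
        gcongr; exact (le_abs_self _).trans (hE.bd _ x)
    _ = _ := by ring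

theorem bound_of_sr_lt (hE : UnitSp ev e) {T : E →L[ℝ] E} (hT : PosOp ev T) {m : ℝ}
    (hm : sr T < m) : ∃ C : ℝ, ∀ n : ℕ, ‖T ^ n‖ ≤ C * m ^ n := by
  have hm0 : 0 < m := (sr_nonneg T).trans_lt hm
  set B : Set ℝ := {μ | 0 < μ ∧ ∃ C : ℝ, ∀ n : ℕ, ‖T ^ n‖ ≤ C * μ ^ n} with hB
  by_contra hcon
  have hne : B.Nonempty := by
    refine ⟨‖T‖ + 1, by positivity, 1, fun n => ?_⟩
    rw [one_mul]
    exact (norm_pow_le T n).trans (pow_le_pow_left₀ (norm_nonneg _) (by linarith) n)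
  have hup : ∀ x ∈ B, ∀ y, x ≤ y → y ∈ B := by
    rintro x ⟨hx, C, hC⟩ y hxy
    have hC0 : 0 ≤ C := by
      have := hC 0; rw [pow_zero, pow_zero, mul_one] at this
      exact (norm_nonneg _).trans this
    exact ⟨hx.trans_le hxy, C, fun n => (hC n).trans
      (mul_le_mul_of_nonneg_left (pow_le_pow_left₀ hx.le hxy n) hC0)⟩
  have hmB : ∀ x ∈ B, m ≤ x := by
    intro x hx
    by_contra hlt
    push Not at hlt
    exact hcon (hup x hx m hlt.le).2
  set ν := sInf B with hν
  have hmν : m ≤ ν := le_csInf hne hmB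
  have hν0 : 0 < ν := hm0.trans_le hmν
  have hbdd : BddBelow B := ⟨m, hmB⟩
  have hnotin : ν ∉ spectrum ℝ T := fun h => by
    have := le_sr h
    rw [abs_of_pos hν0] at this
    linarith
  have hunit : IsUnit (algebraMap ℝ (E →L[ℝ] E) ν - T) := spectrum.notMem_iff.1 hnotin
  obtain ⟨u, hu⟩ := hunit
  have hpos : ∀ l, ν < l → PosOp ev (Ring.inverse (algebraMap ℝ (E →L[ℝ] E) l - T)) := by
    intro l hl
    obtain ⟨μ, ⟨hμ0, C, hC⟩, hμl⟩ := exists_lt_of_csInf_lt hne hl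
    exact inv_pos_aux hT hμ0 hμl hC
  have hRpos : PosOp ev (↑u⁻¹ : E →L[ℝ] E) := by
    have hc : ContinuousAt (fun l : ℝ => Ring.inverse (algebraMap ℝ (E →L[ℝ] E) l - T)) ν := by
      have h1 := NormedRing.inverse_continuousAt u
      rw [hu] at h1
      exact ContinuousAt.comp (f := fun l : ℝ => algebraMap ℝ (E →L[ℝ] E) l - T) h1
        ((continuous_algebraMap ℝ _).sub continuous_const).continuousAt
    have h2 : Tendsto (fun l : ℝ => Ring.inverse (algebraMap ℝ (E →L[ℝ] E) l - T))
        (𝓝[>] ν) (𝓝 (↑u⁻¹ : E →L[ℝ] E)) := by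
      have := hc.tendsto
      rw [← hu, Ring.inverse_unit] at this
      exact this.mono_left nhdsWithin_le_nhds
    exact posOp_closed.mem_of_tendsto h2
      (eventually_nhdsWithin_of_forall fun l hl => hpos l hl)
  have huR : (algebraMap ℝ (E →L[ℝ] E) ν - T) * (↑u⁻¹ : E →L[ℝ] E) = 1 := by
    rw [← hu]; exact u.mul_inv
  obtain ⟨μ, hμ0, hμν, hμB⟩ := bound_aux hE hT hν0 hRpos huR
  have := csInf_le hbdd (show μ ∈ B from ⟨hμ0, hμB⟩)
  linarith

theorem sr_mono (hE : UnitSp ev e) {S T : E →L[ℝ] E} (hS : PosOp ev S) (hT : PosOp ev T)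
    {s : ℝ} (hs : 0 < s)
    (h : ∀ w : E, (∀ x, 0 ≤ ev x w) → ∀ x, s * ev x (S w) ≤ ev x (T w)) :
    s * sr S ≤ sr T := by
  refine le_of_forall_gt_imp_ge_of_dense fun m hm => ?_
  obtain ⟨C, hC⟩ := bound_of_sr_lt hE hT hm
  have hm0 : 0 < m := (sr_nonneg T).trans_lt hm
  have key : ∀ n : ℕ, ∀ x, s ^ n * ev x ((S ^ n) e) ≤ ev x ((T ^ n) e) := by
    intro n
    induction n with
    | zero => intro x; simp
    | succ n ih =>
      intro x
      have e1 : (S ^ (n + 1)) e = S ((S ^ n) e) := by rw [pow_succ']; rfl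
      have e2 : (T ^ (n + 1)) e = T ((T ^ n) e) := by rw [pow_succ']; rfl
      rw [e1, e2]
      have h1 : ev x (T (s ^ n • (S ^ n) e)) ≤ ev x (T ((T ^ n) e)) :=
        posOp_mono hT (fun y => by simpa using ih y) x
      have h2 := h ((S ^ n) e) (posOp_pow hS n e (fun y => by simp [hE.one])) x
      simp only [map_smul, smul_eq_mul] at h1
      calc s ^ (n + 1) * ev x (S ((S ^ n) e)) = s ^ n * (s * ev x (S ((S ^ n) e))) := by ring
        _ ≤ s ^ n * ev x (T ((S ^ n) e)) := by gcongr
        _ ≤ _ := h1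
  have : sr S ≤ m / s := by
    refine sr_le_of_bound (C := C) hE hS (by positivity) fun n x => ?_
    have h1 : ev x ((T ^ n) e) ≤ C * m ^ n := (ev_pow_le hE _ x).trans (hC n)
    have h2 := key n x
    rw [div_pow, ← mul_div_assoc, le_div_iff₀ (by positivity)]
    linarith
  rw [le_div_iff₀ hs] at this
  linarith

theorem sr_ge (hE : UnitSp ev e) {T : E →L[ℝ] E} (hT : PosOp ev T) {d : ℝ} (hd : 0 ≤ d)
    (h : ∀ x, d ≤ ev x (T e)) : d ≤ sr T := by
  refine le_of_forall_gt_imp_ge_of_dense fun m hm => ?_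
  obtain ⟨C, hC⟩ := bound_of_sr_lt hE hT hm
  have hm0 : 0 < m := (sr_nonneg T).trans_lt hm
  refine le_of_pow_bound (C := C) hm0 fun n => le_trans ?_ (hC n)
  have key : ∀ n : ℕ, ∀ x, d ^ n ≤ ev x ((T ^ n) e) := by
    intro n
    induction n with
    | zero => intro x; simp [hE.one]
    | succ n ih =>
      intro x
      have e2 : (T ^ (n + 1)) e = T ((T ^ n) e) := by rw [pow_succ']; rfl
      have h1 : ev x (T (d ^ n • e)) ≤ ev x (T ((T ^ n) e)) :=
        posOp_mono hT (fun y => by simpa [hE.one] using ih y) x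
      simp only [map_smul, smul_eq_mul] at h1
      rw [e2, pow_succ]
      refine le_trans ?_ h1
      gcongr
      exact h x
  exact (key n hE.ne.some).trans (ev_pow_le hE _ _)

theorem sr_le_of_le (hE : UnitSp ev e) {T : E →L[ℝ] E} (hT : PosOp ev T) {C : ℝ} (hC : 0 ≤ C)
    (h : ∀ x, ev x (T e) ≤ C) : sr T ≤ C :=
  (sr_le (norm_nonneg _) fun _ hl => spectrum.norm_le_norm_of_mem hl).trans
    (posOp_norm hE hT hC h)

end Abstract

section Laplace

/-- Laplace transform. -/
def Lap (b : ℝ) (f : ℝ → ℝ) : ℝ := ∫ t in Ioi (0 : ℝ), Real.exp (-b * t) * f t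

theorem lap_int {b M : ℝ} {f : ℝ → ℝ} (hb : 0 < b) (hf : Continuous f) (hM : ∀ t, |f t| ≤ M) :
    IntegrableOn (fun t => Real.exp (-b * t) * f t) (Ioi 0) := by
  have h := (exp_neg_integrableOn_Ioi 0 hb).mul_const M
  refine Integrable.mono' h ?_ (Eventually.of_forall fun t => ?_)
  · exact (by fun_prop : Continuous fun t => Real.exp (-b * t) * f t).aestronglyMeasurable
  · rw [norm_mul, Real.norm_of_nonneg (Real.exp_pos _).le]
    exact mul_le_mul_of_nonneg_left (hM t) (Real.exp_pos _).le

theorem shift_Ioi (g : ℝ → ℝ) (d x : ℝ) :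
    ∫ t in Ioi x, g (t + d) = ∫ t in Ioi (x + d), g t := by
  have h := (measurePreserving_add_right (volume : Measure ℝ) d).setIntegral_preimage_emb
    (measurableEmbedding_addRight d) g (Ioi (x + d))
  rw [← h]
  congr 2
  ext t; simp

theorem lap_eq {b M p : ℝ} {f : ℝ → ℝ} (hb : 0 < b) (hf : Continuous f) (hM : ∀ t, |f t| ≤ M)
    (hp : 0 < p) (hper : ∀ t, f (t + p) = f t) :
    (1 - Real.exp (-b * p)) * Lap b f = ∫ t in (0:ℝ)..p, Real.exp (-b * t) * f t := by
  have hi := lap_int hb hf hM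
  have h1 := intervalIntegral.integral_interval_add_Ioi hi
    (hi.mono_set (Ioi_subset_Ioi hp.le))
  have h2 : ∫ t in Ioi p, Real.exp (-b * t) * f t = Real.exp (-b * p) * Lap b f := by
    have := shift_Ioi (fun t => Real.exp (-b * t) * f t) p 0
    rw [zero_add] at this
    rw [← this, Lap, ← integral_const_mul]
    congr 1; ext t
    rw [hper, mul_add, Real.exp_add]; ring
  rw [h2] at h1
  have : Lap b f = ∫ t in Ioi (0:ℝ), Real.exp (-b * t) * f t := rfl
  rw [← this] at h1
  linarith

theorem lap_anti {b₁ b₂ M p : ℝ} {f : ℝ → ℝ} (hb : 0 < b₁) (hbb : b₁ ≤ b₂) (hf : Continuous f)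
    (hM : ∀ t, |f t| ≤ M) (hp : 0 < p) (hper : ∀ t, f (t + p) = f t) (h0 : ∀ t, 0 ≤ f t) :
    (1 - Real.exp (-b₂ * p)) * Lap b₂ f ≤ (1 - Real.exp (-b₁ * p)) * Lap b₁ f := by
  rw [lap_eq hb hf hM hp hper, lap_eq (hb.trans_le hbb) hf hM hp hper]
  refine intervalIntegral.integral_mono_on hp.le (Continuous.intervalIntegrable (by fun_prop) _ _)
    (Continuous.intervalIntegrable (by fun_prop) _ _) fun t ht => ?_
  refine mul_le_mul_of_nonneg_right (Real.exp_le_exp.2 ?_) (h0 t)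
  nlinarith [ht.1]

theorem lap_mono {b₁ b₂ M p : ℝ} {f : ℝ → ℝ} (hb : 0 < b₁) (hbb : b₁ ≤ b₂) (hf : Continuous f)
    (hM : ∀ t, |f t| ≤ M) (hp : 0 < p) (hper : ∀ t, f (t + p) = f t) (h0 : ∀ t, 0 ≤ f t) :
    Real.exp (b₁ * p) * ((1 - Real.exp (-b₁ * p)) * Lap b₁ f) ≤
      Real.exp (b₂ * p) * ((1 - Real.exp (-b₂ * p)) * Lap b₂ f) := by
  rw [lap_eq hb hf hM hp hper, lap_eq (hb.trans_le hbb) hf hM hp hper,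
    ← intervalIntegral.integral_const_mul, ← intervalIntegral.integral_const_mul]
  refine intervalIntegral.integral_mono_on hp.le (Continuous.intervalIntegrable (by fun_prop) _ _)
    (Continuous.intervalIntegrable (by fun_prop) _ _) fun t ht => ?_
  rw [← mul_assoc, ← mul_assoc, ← Real.exp_add, ← Real.exp_add]
  refine mul_le_mul_of_nonneg_right (Real.exp_le_exp.2 ?_) (h0 t)
  nlinarith [ht.2]

theorem lap_const {b : ℝ} (hb : 0 < b) (M : ℝ) : Lap b (fun _ => M) = M / b := by
  rw [Lap, integral_mul_const, integral_exp_mul_Ioi (by linarith)]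
  simp; field_simp

theorem lap_le {b M : ℝ} {f g : ℝ → ℝ} (hb : 0 < b) (hf : Continuous f) (hM : ∀ t, |f t| ≤ M)
    (hg : Continuous g) (hM' : ∀ t, |g t| ≤ M) (h : ∀ t, f t ≤ g t) : Lap b f ≤ Lap b g :=
  setIntegral_mono (lap_int hb hf hM) (lap_int hb hg hM') fun t =>
    mul_le_mul_of_nonneg_left (h t) (Real.exp_pos _).le

theorem lap_abs {b M : ℝ} {f : ℝ → ℝ} (hb : 0 < b) (hf : Continuous f) (hM : ∀ t, |f t| ≤ M) :
    |Lap b f| ≤ M / b := by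
  have hM0 : |M| ≤ M := by rw [abs_of_nonneg ((abs_nonneg _).trans (hM 0))]
  rw [abs_le]
  constructor
  · have := lap_le hb (continuous_const (y := -M)) (fun _ => by simpa using hM0) hf hM
      (fun t => (abs_le.1 (hM t)).1)
    rwa [lap_const hb, neg_div] at this
  · have := lap_le hb hf hM (continuous_const (y := M)) (fun _ => hM0)
      (fun t => (abs_le.1 (hM t)).2)
    rwa [lap_const hb] at this

theorem lap_cont {b M : ℝ} {F : ℝ → ℝ → ℝ} (hb : 0 < b)
    (hF : Continuous fun q : ℝ × ℝ => F q.1 q.2)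
    (hM : ∀ η t, |F η t| ≤ M) : Continuous fun η => Lap b (F η) := by
  refine continuous_of_dominated (bound := fun t => Real.exp (-b * t) * M) ?_ ?_ ?_ ?_
  · intro η
    have : Continuous (F η) := hF.comp (by fun_prop : Continuous fun t : ℝ => (η, t))
    exact (by fun_prop : Continuous fun t => Real.exp (-b * t) * F η t).aestronglyMeasurable
  · intro η
    refine Eventually.of_forall fun t => ?_
    rw [norm_mul, Real.norm_of_nonneg (Real.exp_pos _).le]
    exact mul_le_mul_of_nonneg_left (hM η t) (Real.exp_pos _).le
  · exact (exp_neg_integrableOn_Ioi 0 hb).mul_const M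
  · refine Eventually.of_forall fun t => ?_
    have : Continuous fun η => F η t := hF.comp (by fun_prop : Continuous fun η : ℝ => (η, t))
    fun_prop

theorem conv_mono {k u v : ℝ → ℝ} (hk : Integrable k) (hk0 : ∀ z, 0 ≤ k z) (hu : Continuous u)
    (hv : Continuous v) {M : ℝ} (hMu : ∀ t, |u t| ≤ M) (hMv : ∀ t, |v t| ≤ M)
    (h : ∀ t, u t ≤ v t) (ξ : ℝ) :
    ∫ η, k (η - ξ) * u η ≤ ∫ η, k (η - ξ) * v η := by
  have h1 : ∀ f : ℝ → ℝ, Continuous f → (∀ t, |f t| ≤ M) →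
      Integrable fun η => k (η - ξ) * f η := fun f hf hM =>
    (hk.comp_sub_right ξ).mul_bdd hf.aestronglyMeasurable (Eventually.of_forall hM)
  exact integral_mono (h1 u hu hMu) (h1 v hv hMv) fun t =>
    mul_le_mul_of_nonneg_left (h t) (hk0 _)

end Laplace

section Concrete

theorem unitSp_circle (p : ℝ) [Fact (0 < p)] :
    UnitSp (fun x : AddCircle p => ContinuousMap.evalCLM ℝ x) (1 : C(AddCircle p, ℝ)) where
  ne := inferInstance
  one _ := rfl
  bd w x := w.norm_coe_le_norm x
  le _ _ hC h := (ContinuousMap.norm_le _ hC).2 h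

theorem exists_primitive {p a₀ : ℝ} (hp : 0 < p) {a : ℝ → ℝ} (haC : Continuous a)
    (hap : ∀ ξ, a (ξ + p) = a ξ) (ha₀ : a₀ = (1 / p) * ∫ s in (0:ℝ)..p, a s) :
    ∃ (H : ℝ → ℝ) (N : ℝ), Continuous H ∧ (∀ x, H (x + p) = H x) ∧ (∀ x, |H x| ≤ N) ∧
      ∀ x y, ∫ s in x..y, a s = a₀ * (y - x) + (H y - H x) := by
  have hi : ∀ x y, IntervalIntegrable a volume x y := fun x y => haC.intervalIntegrable x y
  set H : ℝ → ℝ := fun x => (∫ s in (0:ℝ)..x, a s) - a₀ * x with hH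
  have hc : Continuous H := by
    have := intervalIntegral.continuous_primitive hi 0
    fun_prop
  have hd : ∀ x y, ∫ s in x..y, a s = a₀ * (y - x) + (H y - H x) := by
    intro x y
    have := intervalIntegral.integral_add_adjacent_intervals (hi 0 x) (hi x y)
    simp only [hH]
    linarith
  have hper : ∀ x, H (x + p) = H x := by
    intro x
    have h1 := hd x (x + p)
    have h2 := Function.Periodic.intervalIntegral_add_eq (f := a) (T := p) hap x 0
    rw [zero_add] at h2
    rw [h2] at h1
    have h3 : ∫ s in (0:ℝ)..p, a s = a₀ * p := by rw [ha₀]; field_simp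
    rw [h3] at h1
    linarith
  obtain ⟨N, hN⟩ := (isCompact_Icc (a := (0:ℝ)) (b := p)).exists_bound_of_continuousOn
    hc.continuousOn
  refine ⟨H, N, hc, hper, fun x => ?_, hd⟩
  obtain ⟨y, hy, hxy⟩ := Function.Periodic.exists_mem_Ico₀ (f := H) hper hp x
  rw [hxy]
  exact hN y ⟨hy.1, hy.2.le⟩

theorem final_real {r g : ℝ → ℝ} {a₀ κ C : ℝ} 
    (hg0 : ∀ x, a₀ < x → 0 < g x) (hg : ∀ x y, a₀ < x → x < y → g x < g y) (hgc : Continuous g)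
    (hr : ∀ x, a₀ < x → 0 < r x)
    (h1 : ∀ x y, a₀ < x → x ≤ y → r y * g y ≤ r x * g x)
    (h2 : ∀ x y, a₀ < x → x ≤ y →
      Real.exp (κ * x) * (r x * g x) ≤ Real.exp (κ * y) * (r y * g y))
    (h3 : ∀ x, a₀ < x → r x ≤ C / (x - a₀)) :
    (∀ x y, a₀ < x → x < y → r y < r x) ∧ Tendsto r atTop (𝓝 0) ∧
      ContinuousOn r (Ioi a₀) := by
  refine ⟨fun x y hx hxy => ?_, ?_, ?_⟩
  · have e1 := h1 x y hx hxy.le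
    have e2 := hg x y hx hxy
    have e3 := mul_lt_mul_of_pos_left e2 (hr y (hx.trans hxy))
    exact lt_of_mul_lt_mul_right (e3.trans_le e1) (hg0 x hx).le
  · have ht : Tendsto (fun x : ℝ => C / (x - a₀)) atTop (𝓝 0) :=
      tendsto_const_nhds.div_atTop (tendsto_atTop_add_const_right _ _ tendsto_id)
    refine tendsto_of_tendsto_of_tendsto_of_le_of_le' tendsto_const_nhds ht ?_ ?_
    · filter_upwards [eventually_gt_atTop a₀] with x hx using (hr x hx).le
    · filter_upwards [eventually_gt_atTop a₀] with x hx using h3 x hx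
  · intro x hx
    have hx' : a₀ < x := hx
    have hG : ContinuousWithinAt (fun y => r y * g y) (Ioi a₀) x := by
      set G := r x * g x with hGdef
      have hl : Continuous fun y : ℝ => min G (Real.exp (κ * (x - y)) * G) := by fun_prop
      have hu : Continuous fun y : ℝ => max G (Real.exp (κ * (x - y)) * G) := by fun_prop
      have hl' := (hl.tendsto x).mono_left (nhdsWithin_le_nhds (s := Ioi a₀))
      have hu' := (hu.tendsto x).mono_left (nhdsWithin_le_nhds (s := Ioi a₀))
      simp only [sub_self, mul_zero, Real.exp_zero, one_mul, min_self, max_self] at hl' hu'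
      have hexp : ∀ y, Real.exp (κ * (x - y)) * G =
          Real.exp (-(κ * y)) * (Real.exp (κ * x) * G) := by
        intro y
        have : Real.exp (κ * (x - y)) = Real.exp (-(κ * y)) * Real.exp (κ * x) := by
          rw [← Real.exp_add]; congr 1; ring
        rw [this]; ring
      have hcancel : ∀ y z, Real.exp (-(κ * y)) * (Real.exp (κ * y) * z) = z := by
        intro y z; rw [← mul_assoc, ← Real.exp_add]; simp
      refine tendsto_of_tendsto_of_tendsto_of_le_of_le' hl' hu' ?_ ?_
      · filter_upwards [self_mem_nhdsWithin] with y hy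
        rcases le_total x y with h | h
        · refine (min_le_right _ _).trans ?_
          rw [hexp]
          have := mul_le_mul_of_nonneg_left (h2 x y hx' h) (Real.exp_pos (-(κ * y))).le
          rwa [hcancel] at this
        · exact (min_le_left _ _).trans (h1 y x hy h)
      · filter_upwards [self_mem_nhdsWithin] with y hy
        rcases le_total x y with h | h
        · exact (h1 x y hx' h).trans (le_max_left _ _)
        · refine le_trans ?_ (le_max_right _ _)
          rw [hexp]
          have := mul_le_mul_of_nonneg_left (h2 y x hy h) (Real.exp_pos (-(κ * y))).le
          rwa [hcancel] at this
    have hq := hG.div hgc.continuousWithinAt (hg0 x hx').ne'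
    refine hq.congr (fun y hy => ?_) ?_
    · have := (hg0 y hy).ne'; simp only [Pi.div_apply]; field_simp
    · have := (hg0 x hx').ne'; simp only [Pi.div_apply]; field_simp

end Concrete

/-- Properties of the spectral radius `ρ(α)` of the composed operator
`A_α = K ∘ (αI - T)⁻¹`, acting on the Banach space `C(AddCircle p, ℝ)` of continuous
`p`-periodic functions. -/
theorem spectral_radius_properties
    (k : ℝ → ℝ) (hk : H1 k)
    (c p : ℝ) (hc : 0 < c) [hp : Fact (0 < p)]
    (a : ℝ → ℝ) (haC : Continuous a) (hap : ∀ ξ, a (ξ + p) = a ξ)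
    (abar : ℝ) (habar : abar = (1 / p) * ∫ s in (0:ℝ)..p, a s)
    (A : ℝ → C(AddCircle p, ℝ) →L[ℝ] C(AddCircle p, ℝ))
    (hA : ∀ α : ℝ, -1 + abar < α → ∀ w : C(AddCircle p, ℝ), ∀ ξ : ℝ,
      (A α w) (ξ : AddCircle p) =
        ∫ η, k (η - ξ) * ((1 / c) * ∫ ζ in Set.Ici η,
          Real.exp ((1 / c) * ∫ s in ζ..η, (α + 1 - a s)) * w (ζ : AddCircle p))) :
    (∀ α₁ α₂ : ℝ, -1 + abar < α₁ → α₁ < α₂ →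
        spectralRadius ℝ (A α₂) < spectralRadius ℝ (A α₁)) ∧
    Tendsto (fun α => spectralRadius ℝ (A α)) atTop (𝓝 0) ∧
    ContinuousOn (fun α => spectralRadius ℝ (A α)) (Set.Ioi (-1 + abar)) := by
  have hp0 : 0 < p := hp.out
  obtain ⟨hkC, hk0, -, hk1, -, -⟩ := hk
  have hki : Integrable k := by
    by_contra h
    rw [integral_undef h] at hk1
    exact zero_ne_one hk1
  obtain ⟨H, N, hHc, hHp, hHN, hHi⟩ := exists_primitive hp0 haC hap habar
  set F : C(AddCircle p, ℝ) → ℝ → ℝ → ℝ := fun w η t =>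
    Real.exp ((1 / c) * (H (t + η) - H η)) * w ((t + η : ℝ) : AddCircle p) with hF
  set b : ℝ → ℝ := fun α => (1 / c) * (α + 1 - abar) with hbdef
  have hb : ∀ α, -1 + abar < α → 0 < b α := fun α hα => by
    have : 0 < α + 1 - abar := by linarith
    simp only [hbdef]; positivity
  have hbm : ∀ x y, x ≤ y → b x ≤ b y := fun x y h => by
    simp only [hbdef]; gcongr
  have hbm' : ∀ x y, x < y → b x < b y := fun x y h => by
    simp only [hbdef]; gcongr
  have hform : ∀ α, -1 + abar < α → ∀ w ξ, (A α w) ((ξ : ℝ) : AddCircle p) =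
      ∫ η, k (η - ξ) * ((1 / c) * Lap (b α) (F w η)) := by
    intro α hα w ξ
    rw [hA α hα w ξ]
    congr 1; ext η; congr 2
    rw [integral_Ici_eq_integral_Ioi]
    have hs := shift_Ioi (fun ζ => Real.exp ((1 / c) * ∫ s in ζ..η, (α + 1 - a s)) *
      w (ζ : AddCircle p)) η 0
    rw [zero_add] at hs
    rw [← hs, Lap]
    congr 1; ext t
    have e1 : ∫ s in (t + η)..η, (α + 1 - a s) =
        (α + 1) * (η - (t + η)) - (abar * (η - (t + η)) + (H η - H (t + η))) := by
      rw [intervalIntegral.integral_sub intervalIntegrable_const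
        (haC.intervalIntegrable _ _), hHi, intervalIntegral.integral_const, smul_eq_mul]
      ring
    rw [e1]
    simp only [hF, hbdef]
    rw [← mul_assoc, ← Real.exp_add]
    congr 2; ring
  have hwc : ∀ w : C(AddCircle p, ℝ), Continuous fun x : ℝ => w (x : AddCircle p) := fun w =>
    w.continuous.comp (AddCircle.continuous_mk' p)
  have hFc : ∀ w, Continuous fun q : ℝ × ℝ => F w q.1 q.2 := by
    intro w
    have h1 : Continuous fun q : ℝ × ℝ => w ((q.2 + q.1 : ℝ) : AddCircle p) :=
      (hwc w).comp (by fun_prop : Continuous fun q : ℝ × ℝ => q.2 + q.1)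
    simp only [hF]
    fun_prop
  have hFc' : ∀ w η, Continuous (F w η) := fun w η =>
    (hFc w).comp (by fun_prop : Continuous fun t : ℝ => (η, t))
  have hHb : ∀ x y, |H x - H y| ≤ 2 * N := fun x y => by
    have h1 := abs_le.1 (hHN x)
    have h2 := abs_le.1 (hHN y)
    rw [abs_le]; constructor <;> linarith
  set D := Real.exp ((1 / c) * (2 * N)) with hD
  have hDb : ∀ x y, Real.exp ((1 / c) * (H x - H y)) ≤ D := fun x y => by
    rw [hD]; gcongr; exact (abs_le.1 (hHb x y)).2
  have hFM : ∀ w η t, |F w η t| ≤ D * ‖w‖ := by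
    intro w η t
    simp only [hF]
    rw [abs_mul, abs_of_pos (Real.exp_pos _)]
    exact mul_le_mul (hDb _ _) (w.norm_coe_le_norm _) (abs_nonneg _) (Real.exp_pos _).le
  have hFp : ∀ w η t, F w η (t + p) = F w η t := by
    intro w η t
    simp only [hF]
    rw [show t + p + η = (t + η) + p by ring, hHp, AddCircle.coe_add_period]
  have hF0 : ∀ w, (∀ x, 0 ≤ w x) → ∀ η t, 0 ≤ F w η t := fun w hw η t =>
    mul_nonneg (Real.exp_pos _).le (hw _)
  -- the inner function
  set V : ℝ → C(AddCircle p, ℝ) → ℝ → ℝ := fun α w η => (1 / c) * Lap (b α) (F w η) with hV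
  have hVc : ∀ α, -1 + abar < α → ∀ w, Continuous (V α w) := fun α hα w =>
    continuous_const.mul (lap_cont (hb α hα) (hFc w) (hFM w))
  have hVb : ∀ α, -1 + abar < α → ∀ w η, |V α w η| ≤ (1 / c) * (D * ‖w‖ / b α) := by
    intro α hα w η
    simp only [hV]
    rw [abs_mul, abs_of_pos (by positivity : 0 < 1 / c)]
    exact mul_le_mul_of_nonneg_left (lap_abs (hb α hα) (hFc' w η) (hFM w η)) (by positivity)
  have hkey : ∀ α α', -1 + abar < α → -1 + abar < α' → ∀ w w' s s', 
      (∀ η, s * V α w η ≤ s' * V α' w' η) → 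
      ∀ x : AddCircle p, s * (A α w) x ≤ s' * (A α' w') x := by
    intro α α' hα hα' w w' s s' h x
    obtain ⟨ξ, rfl⟩ := QuotientAddGroup.mk_surjective x
    have e1 := hform α hα w ξ
    have e2 := hform α' hα' w' ξ
    change s * (A α w) (ξ : AddCircle p) ≤ s' * (A α' w') (ξ : AddCircle p)
    have e3 : ∀ (s α : ℝ) w, ∫ η, k (η - ξ) * (s * V α w η) =
        s * ∫ η, k (η - ξ) * ((1 / c) * Lap (b α) (F w η)) := by
      intro s α w
      rw [← integral_const_mul]
      congr 1; ext η
      have : V α w η = (1 / c) * Lap (b α) (F w η) := rfl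
      rw [this]; ring
    rw [e1, e2]
    have h3 := conv_mono (u := fun η => s * V α w η) (v := fun η => s' * V α' w' η) hki hk0
      ((hVc α hα w).const_mul s) ((hVc α' hα' w').const_mul s')
      (M := max (|s| * ((1 / c) * (D * ‖w‖ / b α))) (|s'| * ((1 / c) * (D * ‖w'‖ / b α'))))
      (fun t => by
        refine le_trans ?_ (le_max_left _ _)
        rw [abs_mul]
        exact mul_le_mul_of_nonneg_left (hVb α hα w t) (abs_nonneg _))
      (fun t => by
        refine le_trans ?_ (le_max_right _ _)
        rw [abs_mul]
        exact mul_le_mul_of_nonneg_left (hVb α' hα' w' t) (abs_nonneg _)) h ξ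
    rw [e3, e3] at h3
    exact h3
  have hV0 : ∀ α, -1 + abar < α → ∀ w, (∀ x, 0 ≤ w x) → ∀ η, 0 ≤ V α w η := by
    intro α hα w hw η
    refine mul_nonneg (by positivity) ?_
    exact integral_nonneg fun t => mul_nonneg (Real.exp_pos _).le (hF0 w hw η t)
  have hE := unitSp_circle p
  have hpos : ∀ α, -1 + abar < α →
      PosOp (fun x : AddCircle p => ContinuousMap.evalCLM ℝ x) (A α) := by
    intro α hα w hw x
    have := hkey α α hα hα w w 0 1 (fun η => by
      rw [zero_mul, one_mul]; exact hV0 α hα w hw η) x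
    rw [zero_mul, one_mul] at this
    exact this
  -- bounds on A 1
  have hconst : ∀ (M ξ : ℝ), ∫ η, k (η - ξ) * M = M := by
    intro M ξ
    rw [integral_mul_const, integral_sub_right_eq_self k ξ, hk1, one_mul]
  have hF1 : ∀ η t, D⁻¹ ≤ F 1 η t ∧ F 1 η t ≤ D := by
    intro η t
    simp only [hF, ContinuousMap.one_apply, mul_one]
    refine ⟨?_, hDb _ _⟩
    rw [hD, ← Real.exp_neg, ← mul_neg]
    gcongr
    exact (abs_le.1 (hHb _ _)).1
  have hD0 : 0 < D := Real.exp_pos _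
  have hD1 : 1 ≤ D := by
    have h1 := hF1 0 0
    have h2 := h1.1.trans h1.2
    by_contra h
    push Not at h
    have := (one_lt_inv₀ hD0).2 h
    linarith
  have hDi : D⁻¹ ≤ D := (hF1 0 0).1.trans (hF1 0 0).2
  have hF1a : ∀ η t, |F 1 η t| ≤ D := fun η t => by
    rw [abs_of_nonneg ((inv_nonneg.2 hD0.le).trans (hF1 η t).1)]; exact (hF1 η t).2
  have hV1 : ∀ α, -1 + abar < α → ∀ η,
      (1 / c) * (D⁻¹ / b α) ≤ V α 1 η ∧ V α 1 η ≤ (1 / c) * (D / b α) := by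
    intro α hα η
    have i0 : |D⁻¹| ≤ D := by rwa [abs_of_pos (inv_pos.2 hD0)]
    have i1 : |D| ≤ D := by rw [abs_of_pos hD0]
    have h1 := lap_le (hb α hα) (continuous_const (y := D⁻¹)) (fun _ => i0) (hFc' 1 η) (hF1a η)
      (fun t => (hF1 η t).1)
    have h2 := lap_le (hb α hα) (hFc' 1 η) (hF1a η) (continuous_const (y := D)) (fun _ => i1)
      (fun t => (hF1 η t).2)
    rw [lap_const (hb α hα)] at h1 h2
    exact ⟨mul_le_mul_of_nonneg_left h1 (by positivity),
      mul_le_mul_of_nonneg_left h2 (by positivity)⟩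
  have hA1 : ∀ α, -1 + abar < α → ∀ x : AddCircle p,
      (1 / c) * (D⁻¹ / b α) ≤ A α 1 x ∧ A α 1 x ≤ (1 / c) * (D / b α) := by
    intro α hα x
    obtain ⟨ξ, rfl⟩ := QuotientAddGroup.mk_surjective x
    have e1 := hform α hα 1 ξ
    change (1 / c) * (D⁻¹ / b α) ≤ A α 1 (ξ : AddCircle p) ∧
      A α 1 (ξ : AddCircle p) ≤ (1 / c) * (D / b α)
    have hbα := hb α hα
    have m1 : |(1 / c) * (D⁻¹ / b α)| ≤ (1 / c) * (D / b α) := by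
      rw [abs_of_pos (by positivity)]; gcongr
    have m2 : |(1 / c) * (D / b α)| ≤ (1 / c) * (D / b α) := by
      rw [abs_of_pos (by positivity)]
    have m3 : ∀ η, |V α 1 η| ≤ (1 / c) * (D / b α) := fun η => by
      rw [abs_of_nonneg (hV0 α hα 1 (fun x => zero_le_one) η)]; exact (hV1 α hα η).2
    rw [e1]
    constructor
    · have := conv_mono hki hk0 continuous_const (hVc α hα 1) (fun _ => m1) m3
        (fun η => (hV1 α hα η).1) ξ
      rwa [hconst] at this
    · have := conv_mono hki hk0 (hVc α hα 1) continuous_const m3 (fun _ => m2)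
        (fun η => (hV1 α hα η).2) ξ
      rwa [hconst] at this
  -- real-valued conclusion
  have hg0 : ∀ α, -1 + abar < α → 0 < 1 - Real.exp (-b α * p) := fun α hα => by
    have : Real.exp (-b α * p) < 1 := by
      rw [← Real.exp_zero]; exact Real.exp_lt_exp.2 (by nlinarith [hb α hα])
    linarith
  have hcomp : ∀ α α', -1 + abar < α → -1 + abar < α' → ∀ s s', 0 < s → 0 < s' →
      (∀ w : C(AddCircle p, ℝ), (∀ x, 0 ≤ w x) → ∀ η,
        s * Lap (b α) (F w η) ≤ s' * Lap (b α') (F w η)) →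
      s * sr (A α) ≤ s' * sr (A α') := by
    intro α α' hα hα' s s' hs hs' h
    have := sr_mono hE (hpos α hα) (hpos α' hα') (div_pos hs hs') (fun w hw x => by
      have h1 := hkey α α' hα hα' w w s s' (fun η => by
        have := mul_le_mul_of_nonneg_left (h w hw η) (by positivity : 0 ≤ 1 / c)
        simp only [hV]; linarith) x
      rw [div_mul_eq_mul_div, div_le_iff₀ hs', mul_comm _ s']
      exact h1)
    rwa [div_mul_eq_mul_div, div_le_iff₀ hs', mul_comm _ s'] at this
  have hfin := final_real (r := fun α => sr (A α)) (g := fun α => 1 - Real.exp (-b α * p))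
    (a₀ := -1 + abar) (κ := p / c) (C := D) hg0
    (fun x y _ hxy => by
      have := hbm' x y hxy
      have h2 : Real.exp (-b y * p) < Real.exp (-b x * p) :=
        Real.exp_lt_exp.2 (by nlinarith)
      linarith)
    (by simp only [hbdef]; fun_prop)
    (fun x hx => by
      have hbx := hb x hx
      exact lt_of_lt_of_le (by positivity)
        (sr_ge hE (hpos x hx) (d := (1 / c) * (D⁻¹ / b x)) (by positivity)
          fun y => (hA1 x hx y).1))
    (fun x y hx hxy => by
      have hy := hx.trans_le hxy
      have := hcomp y x hy hx _ _ (hg0 y hy) (hg0 x hx) (fun w hw η =>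
        lap_anti (hb x hx) (hbm x y hxy) (hFc' w η) (hFM w η) hp0 (hFp w η) (hF0 w hw η))
      linarith)
    (fun x y hx hxy => by
      have hy := hx.trans_le hxy
      have h1 := hcomp x y hx hy (Real.exp (b x * p) * (1 - Real.exp (-b x * p)))
        (Real.exp (b y * p) * (1 - Real.exp (-b y * p)))
        (mul_pos (Real.exp_pos _) (hg0 x hx)) (mul_pos (Real.exp_pos _) (hg0 y hy))
        (fun w hw η => by
          have := lap_mono (hb x hx) (hbm x y hxy) (hFc' w η) (hFM w η) hp0 (hFp w η)
            (hF0 w hw η)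
          rw [← mul_assoc, ← mul_assoc] at this
          exact this)
      have h2 : ∀ z, Real.exp (b z * p) = Real.exp (p / c * (1 - abar)) * Real.exp (p / c * z) := by
        intro z; rw [← Real.exp_add]; congr 1; simp only [hbdef]; ring
      rw [h2 x, h2 y] at h1
      refine le_of_mul_le_mul_left ?_ (Real.exp_pos (p / c * (1 - abar)))
      linarith)
    (fun x hx => by
      have hbx := hb x hx
      have h1 := sr_le_of_le hE (hpos x hx) (C := (1 / c) * (D / b x)) (by positivity)
          fun y => (hA1 x hx y).2
      refine h1.trans (le_of_eq ?_)
      have : 0 < x - (-1 + abar) := by linarith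
      simp only [hbdef]
      rw [show x + 1 - abar = x - (-1 + abar) by ring]
      field_simp)
  have hsr : ∀ α, spectralRadius ℝ (A α) = ENNReal.ofReal (sr (A α)) := fun α =>
    (ENNReal.ofReal_toReal (spec_ne_top (A α))).symm
  simp only [hsr]
  obtain ⟨g1, g2, g3⟩ := hfin
  refine ⟨fun x y hx hxy => ?_, ?_, ?_⟩
  · exact (ENNReal.ofReal_lt_ofReal_iff_of_nonneg (sr_nonneg _)).2 (g1 x y hx hxy)
  · have := ENNReal.tendsto_ofReal g2
    simpa using this
  · exact ENNReal.continuous_ofReal.comp_continuousOn g3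
end
end

section
/- (Existence of the principal eigenvalue in the periodic case.) Assume (H1). Let c>0, p>0, and let a:ℝ→ℝ be Lipschitz continuous with a(ξ+p)=a(ξ) for all ξ, and set ā = (1/p)∫₀^p a(s) ds. Then there exist λ∈ℝ with λ > −1 + ā and a C¹ p-periodic function φ:ℝ→(0,∞) such that c φ'(ξ)+∫_ℝ k(η−ξ) φ(η) dη − φ(ξ) + a(ξ) φ(ξ) = λ φ(ξ) for all ξ∈ℝ. -/
open MeasureTheory Real Set Filter Topology

noncomputable section

/-- Data for the reduced problem. -/
structure PData (k : ℝ → ℝ) (q : ℝ → ℝ → ℝ) (c p D : ℝ) : Prop where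
  kc : Continuous k
  k0 : ∀ z, 0 ≤ k z
  ki : Integrable k
  k1 : (∫ z, k z) = 1
  kp : 0 < k 0
  qc : Continuous (Function.uncurry q)
  ql : ∀ x y, 1 / D ≤ q x y
  qu : ∀ x y, q x y ≤ D
  qp : ∀ x y, q (x + p) (y + p) = q x y
  hc : 0 < c
  hp : 0 < p
  hD : 0 < D

/-- Continuous and periodic. -/
def CPer (p : ℝ) (u : ℝ → ℝ) : Prop := Continuous u ∧ ∀ x, u (x + p) = u x

/-- The weighted convolution. -/
def opH (k : ℝ → ℝ) (q : ℝ → ℝ → ℝ) (u : ℝ → ℝ) (x : ℝ) : ℝ :=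
  ∫ z, k z * (q x (x + z) * u (x + z))

/-- The unnormalized periodic resolvent applied to `opH`. -/
def opS (k : ℝ → ℝ) (q : ℝ → ℝ → ℝ) (p κ : ℝ) (u : ℝ → ℝ) (x : ℝ) : ℝ :=
  ∫ s in (0:ℝ)..p, Real.exp (-(κ * s)) * opH k q u (x + s)

/-- Normalization. -/
def opN (c p κ : ℝ) : ℝ := c * (1 - Real.exp (-(κ * p)))

theorem CPer.bdd {p : ℝ} {u : ℝ → ℝ} (hu : CPer p u) (hp : 0 < p) :
    ∃ M, 0 ≤ M ∧ ∀ x, |u x| ≤ M := by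
  have h : Function.Periodic u p := hu.2
  obtain ⟨M, hM⟩ := (h.isBounded_of_continuous hp.ne' hu.1).exists_norm_le
  exact ⟨M, (norm_nonneg _).trans (hM (u 0) ⟨0, rfl⟩), fun x => hM _ ⟨x, rfl⟩⟩

theorem CPer.exists_max {p : ℝ} {u : ℝ → ℝ} (hu : CPer p u) (hp : 0 < p) :
    ∃ x0 ∈ Icc 0 p, ∀ x, u x ≤ u x0 := by
  have h : Function.Periodic u p := hu.2
  obtain ⟨x0, h0, hm⟩ := (isCompact_Icc (a := (0:ℝ)) (b := p)).exists_isMaxOn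
    ⟨0, by simp [hp.le]⟩ hu.1.continuousOn
  refine ⟨x0, h0, fun x => ?_⟩
  obtain ⟨y, hy, e⟩ := h.exists_mem_Ico₀ hp x
  rw [e]
  exact hm (Ico_subset_Icc_self hy)

namespace PData

variable {k : ℝ → ℝ} {q : ℝ → ℝ → ℝ} {c p D : ℝ}

theorem qpos (h : PData k q c p D) (x y : ℝ) : 0 < q x y :=
  lt_of_lt_of_le (by have := h.hD; positivity) (h.ql x y)

theorem fcont (h : PData k q c p D) {u : ℝ → ℝ} (hu : Continuous u) (x : ℝ) :
    Continuous (fun z => k z * (q x (x + z) * u (x + z))) := by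
  have h1 := h.kc
  have h2 : Continuous (fun z => q x (x + z)) :=
    h.qc.comp (Continuous.prodMk continuous_const (by fun_prop))
  exact h1.mul (h2.mul (hu.comp (by fun_prop)))

theorem fbound (h : PData k q c p D) {u : ℝ → ℝ} {M : ℝ} (hM : ∀ x, |u x| ≤ M) (x z : ℝ) :
    ‖k z * (q x (x + z) * u (x + z))‖ ≤ k z * (D * M) := by
  rw [Real.norm_eq_abs, abs_mul, abs_mul, abs_of_nonneg (h.k0 z), abs_of_pos (h.qpos _ _)]
  have := h.k0 z
  have := h.hD
  have := h.qu x (x + z)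
  have := hM (x + z)
  gcongr

theorem fint (h : PData k q c p D) {u : ℝ → ℝ} (hu : CPer p u) (x : ℝ) :
    Integrable (fun z => k z * (q x (x + z) * u (x + z))) := by
  obtain ⟨M, -, hM⟩ := hu.bdd h.hp
  exact (h.ki.mul_const (D * M)).mono' (h.fcont hu.1 x).aestronglyMeasurable
    (Eventually.of_forall (h.fbound hM x))

theorem Hper (h : PData k q c p D) {u : ℝ → ℝ} (hu : CPer p u) : CPer p (opH k q u) := by
  constructor
  · obtain ⟨M, -, hM⟩ := hu.bdd h.hp
    refine continuous_of_dominated (bound := fun z => k z * (D * M))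
      (fun x => (h.fcont hu.1 x).aestronglyMeasurable)
      (fun x => Eventually.of_forall (h.fbound hM x)) (h.ki.mul_const _)
      (Eventually.of_forall fun z => ?_)
    have h1 := hu.1
    have h2 : Continuous (fun x => q x (x + z)) :=
      h.qc.comp (Continuous.prodMk continuous_id (by fun_prop))
    exact continuous_const.mul (h2.mul (h1.comp (by fun_prop)))
  · intro x
    unfold opH
    congr 1
    ext z
    rw [show x + p + z = (x + z) + p by ring, h.qp, hu.2]

theorem H_nonneg (h : PData k q c p D) {u : ℝ → ℝ} (hu : ∀ x, 0 ≤ u x) (x : ℝ) :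
    0 ≤ opH k q u x :=
  integral_nonneg fun z => mul_nonneg (h.k0 z) (mul_nonneg (h.qpos _ _).le (hu _))

theorem H_le (h : PData k q c p D) {u : ℝ → ℝ} (hu : CPer p u) {M : ℝ} (hM : ∀ x, |u x| ≤ M)
    (x : ℝ) : opH k q u x ≤ D * M := by
  have : opH k q u x ≤ ∫ z, k z * (D * M) :=
    integral_mono (h.fint hu x) (h.ki.mul_const _)
      (fun z => (le_abs_self _).trans (h.fbound hM x z))
  rwa [integral_mul_const, h.k1, one_mul] at this

theorem H_pos (h : PData k q c p D) {u : ℝ → ℝ} (hu : CPer p u) (h0 : ∀ x, 0 ≤ u x)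
    {x : ℝ} (hx : 0 < u x) : 0 < opH k q u x := by
  refine integral_pos_of_integrable_nonneg_nonzero (x := 0) (h.fcont hu.1 x) (h.fint hu x)
    (fun z => mul_nonneg (h.k0 z) (mul_nonneg (h.qpos _ _).le (h0 _))) ?_
  have := h.kp
  have := h.qpos x x
  simp only [add_zero]
  positivity

theorem H_one (h : PData k q c p D) (x : ℝ) : 1 / D ≤ opH k q (fun _ => 1) x := by
  have h1 : CPer p (fun _ => (1:ℝ)) := ⟨continuous_const, fun _ => rfl⟩
  have : ∫ z, k z * (1 / D) ≤ opH k q (fun _ => 1) x :=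
    integral_mono (h.ki.mul_const _) (h.fint h1 x)
      (fun z => by
        have := h.ql x (x + z)
        have := h.k0 z
        simp only [mul_one]
        gcongr)
  rwa [integral_mul_const, h.k1, one_mul] at this

theorem H_sub (h : PData k q c p D) {u v : ℝ → ℝ} (hu : CPer p u) (hv : CPer p v) (x : ℝ) :
    opH k q (fun y => v y - u y) x = opH k q v x - opH k q u x := by
  unfold opH
  rw [← integral_sub (h.fint hv x) (h.fint hu x)]
  congr 1
  ext z
  ring

theorem H_smul (u : ℝ → ℝ) (r x : ℝ) :
    opH k q (fun y => r * u y) x = r * opH k q u x := by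
  unfold opH
  rw [← integral_const_mul]
  congr 1
  ext z
  ring

theorem H_tendsto (h : PData k q c p D) {U : ℕ → ℝ → ℝ} {u : ℝ → ℝ}
    (hU : ∀ n, Continuous (U n)) (hb : ∀ n x, |U n x| ≤ 1)
    (hl : ∀ x, Tendsto (fun n => U n x) atTop (𝓝 (u x))) (x : ℝ) :
    Tendsto (fun n => opH k q (U n) x) atTop (𝓝 (opH k q u x)) := by
  refine tendsto_integral_filter_of_dominated_convergence (fun z => k z * (D * 1))
    (Eventually.of_forall fun n => (h.fcont (hU n) x).aestronglyMeasurable)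
    (Eventually.of_forall fun n => Eventually.of_forall (h.fbound (hb n) x))
    (h.ki.mul_const _) (Eventually.of_forall fun z => ?_)
  exact ((hl _).const_mul _).const_mul _

theorem gcont (h : PData k q c p D) {u : ℝ → ℝ} (hu : CPer p u) (κ x : ℝ) :
    Continuous (fun s => Real.exp (-(κ * s)) * opH k q u (x + s)) := by
  have := (h.Hper hu).1
  fun_prop

theorem S_cont2 (h : PData k q c p D) {u : ℝ → ℝ} (hu : CPer p u) :
    Continuous (fun y : ℝ × ℝ => opS k q p y.1 u y.2) := by
  have := (h.Hper hu).1
  refine intervalIntegral.continuous_parametric_intervalIntegral_of_continuous'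
    (f := fun y : ℝ × ℝ => fun s => Real.exp (-(y.1 * s)) * opH k q u (y.2 + s)) ?_ 0 p
  simp only [Function.uncurry_def]
  fun_prop

theorem S_per (h : PData k q c p D) {u : ℝ → ℝ} (hu : CPer p u) (κ : ℝ) :
    CPer p (opS k q p κ u) := by
  refine ⟨(h.S_cont2 hu).comp (Continuous.prodMk continuous_const continuous_id), fun x => ?_⟩
  unfold opS
  congr 1
  ext s
  rw [show x + p + s = (x + s) + p by ring, (h.Hper hu).2]

theorem S_nonneg (h : PData k q c p D) {u : ℝ → ℝ} (h0 : ∀ x, 0 ≤ u x) (κ x : ℝ) :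
    0 ≤ opS k q p κ u x :=
  intervalIntegral.integral_nonneg h.hp.le fun _ _ =>
    mul_nonneg (Real.exp_pos _).le (h.H_nonneg h0 _)

theorem S_pos (h : PData k q c p D) {u : ℝ → ℝ} (hu : CPer p u) (h0 : ∀ x, 0 ≤ u x)
    {x0 : ℝ} (hx : 0 < u x0) (κ x : ℝ) : 0 < opS k q p κ u x := by
  refine intervalIntegral.integral_pos h.hp (h.gcont hu κ x).continuousOn
    (fun s _ => mul_nonneg (Real.exp_pos _).le (h.H_nonneg h0 _)) ?_
  have hP : Function.Periodic (opH k q u) p := (h.Hper hu).2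
  obtain ⟨y, hy, e⟩ := hP.exists_mem_Ico h.hp x0 x
  refine ⟨y - x, ⟨by linarith [hy.1], by linarith [hy.2]⟩, mul_pos (Real.exp_pos _) ?_⟩
  rw [show x + (y - x) = y by ring, ← e]
  exact h.H_pos hu h0 hx

theorem S_sub (h : PData k q c p D) {u v : ℝ → ℝ} (hu : CPer p u) (hv : CPer p v) (κ x : ℝ) :
    opS k q p κ (fun y => v y - u y) x = opS k q p κ v x - opS k q p κ u x := by
  unfold opS
  rw [← intervalIntegral.integral_sub ((h.gcont hv κ x).intervalIntegrable _ _)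
    ((h.gcont hu κ x).intervalIntegrable _ _)]
  congr 1
  ext s
  rw [h.H_sub hu hv]
  ring

theorem S_smul (u : ℝ → ℝ) (r κ x : ℝ) :
    opS k q p κ (fun y => r * u y) x = r * opS k q p κ u x := by
  unfold opS
  rw [← intervalIntegral.integral_const_mul]
  congr 1
  ext s
  rw [H_smul]
  ring

theorem S_mono (h : PData k q c p D) {u v : ℝ → ℝ} (hu : CPer p u) (hv : CPer p v)
    (huv : ∀ x, u x ≤ v x) (κ x : ℝ) : opS k q p κ u x ≤ opS k q p κ v x := by
  have := h.S_nonneg (u := fun y => v y - u y) (fun y => sub_nonneg.2 (huv y)) κ x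
  rw [h.S_sub hu hv] at this
  linarith

theorem integral_exp_aux {κ : ℝ} (hκ : 0 < κ) (p : ℝ) :
    ∫ s in (0:ℝ)..p, Real.exp (-(κ * s)) = (1 - Real.exp (-(κ * p))) / κ := by
  have hd : ∀ s ∈ uIcc 0 p, HasDerivAt (fun s => -Real.exp (-(κ * s)) / κ)
      (Real.exp (-(κ * s))) s := by
    intro s _
    have h1 : HasDerivAt (fun s : ℝ => -(κ * s)) (-κ) s := by
      have := ((hasDerivAt_id s).const_mul κ).neg
      rw [mul_one] at this
      exact this
    have := (h1.exp.neg).div_const κ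
    have e : -(Real.exp (-(κ * s)) * -κ) / κ = Real.exp (-(κ * s)) := by
      field_simp
    rw [e] at this
    exact this
  rw [intervalIntegral.integral_eq_sub_of_hasDerivAt hd
    ((by fun_prop : Continuous fun s => Real.exp (-(κ * s))).intervalIntegrable _ _)]
  simp
  ring

theorem S_le (h : PData k q c p D) {u : ℝ → ℝ} (hu : CPer p u) {M : ℝ} (hM : ∀ x, |u x| ≤ M)
    {κ : ℝ} (hκ : 0 < κ) (x : ℝ) :
    opS k q p κ u x ≤ (1 - Real.exp (-(κ * p))) / κ * (D * M) := by
  rw [← integral_exp_aux hκ, ← intervalIntegral.integral_mul_const]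
  refine intervalIntegral.integral_mono_on h.hp.le ((h.gcont hu κ x).intervalIntegrable _ _)
    ((by fun_prop : Continuous fun s => Real.exp (-(κ * s)) * (D * M)).intervalIntegrable _ _)
    (fun s _ => ?_)
  have := h.H_le hu hM (x + s)
  gcongr

theorem S_one (h : PData k q c p D) {κ : ℝ} (hκ : 0 < κ) (x : ℝ) :
    (1 - Real.exp (-(κ * p))) / κ * (1 / D) ≤ opS k q p κ (fun _ => 1) x := by
  have h1 : CPer p (fun _ => (1:ℝ)) := ⟨continuous_const, fun _ => rfl⟩
  rw [← integral_exp_aux hκ, ← intervalIntegral.integral_mul_const]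
  refine intervalIntegral.integral_mono_on h.hp.le
    ((by fun_prop : Continuous fun s => Real.exp (-(κ * s)) * (1 / D)).intervalIntegrable _ _)
    ((h.gcont h1 κ x).intervalIntegrable _ _)
    (fun s _ => ?_)
  have := h.H_one (x + s)
  gcongr

theorem S_tendsto (h : PData k q c p D) {U : ℕ → ℝ → ℝ} {u : ℝ → ℝ} {K : ℕ → ℝ} {κ : ℝ}
    (hU : ∀ n, CPer p (U n)) (hb : ∀ n x, |U n x| ≤ 1) (h0 : ∀ n x, 0 ≤ U n x)
    (hK : ∀ n, 0 ≤ K n) (hKl : Tendsto K atTop (𝓝 κ))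
    (hl : ∀ x, Tendsto (fun n => U n x) atTop (𝓝 (u x))) (x : ℝ) :
    Tendsto (fun n => opS k q p (K n) (U n) x) atTop (𝓝 (opS k q p κ u x)) := by
  refine intervalIntegral.tendsto_integral_filter_of_dominated_convergence (fun _ => 1 * (D * 1))
    (Eventually.of_forall fun n => (h.gcont (hU n) (K n) x).aestronglyMeasurable)
    (Eventually.of_forall fun n => Eventually.of_forall fun s hs => ?_)
    (continuous_const.intervalIntegrable _ _)
    (Eventually.of_forall fun s _ => ?_)
  · rw [uIoc_of_le h.hp.le] at hs
    rw [Real.norm_eq_abs, abs_mul, abs_of_pos (Real.exp_pos _),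
      abs_of_nonneg (h.H_nonneg (h0 n) _)]
    have h1 := h.H_le (hU n) (hb n) (x + s)
    have h2 : Real.exp (-(K n * s)) ≤ 1 :=
      Real.exp_le_one_iff.2 (by have := mul_nonneg (hK n) hs.1.le; linarith)
    exact mul_le_mul h2 h1 (h.H_nonneg (h0 n) _) zero_le_one
  · refine Tendsto.mul ?_ (h.H_tendsto (fun n => (hU n).1) hb hl _)
    exact (Real.continuous_exp.tendsto _).comp (hKl.mul_const s).neg

theorem N_pos (h : PData k q c p D) {κ : ℝ} (hκ : 0 < κ) : 0 < opN c p κ := by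
  have := Real.exp_lt_one_iff.2 (show -(κ * p) < 0 by have := mul_pos hκ h.hp; linarith)
  exact mul_pos h.hc (by linarith)

theorem S_deriv (h : PData k q c p D) {u : ℝ → ℝ} (hu : CPer p u) (κ x : ℝ) :
    HasDerivAt (opS k q p κ u)
      (κ * opS k q p κ u x - (1 - Real.exp (-(κ * p))) * opH k q u x) x := by
  have hH := (h.Hper hu).1
  set g : ℝ → ℝ := fun t => Real.exp (-(κ * t)) * opH k q u t with hg
  have hgc : Continuous g := by fun_prop
  set G : ℝ → ℝ := fun y => ∫ t in (0:ℝ)..y, g t with hG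
  have hGd : ∀ y, HasDerivAt G (g y) y := fun y => (hgc.integral_hasStrictDerivAt 0 y).hasDerivAt
  have e : opS k q p κ u = fun y => Real.exp (κ * y) * (G (y + p) - G y) := by
    ext y
    have h1 : G (y + p) - G y = ∫ t in y..(y + p), g t := by
      rw [hG]
      exact intervalIntegral.integral_interval_sub_left (hgc.intervalIntegrable _ _)
        (hgc.intervalIntegrable _ _)
    have h2 := intervalIntegral.integral_comp_add_left (a := 0) (b := p) g y
    rw [add_zero] at h2
    rw [h1, ← h2, ← intervalIntegral.integral_const_mul]
    unfold opS
    congr 1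
    ext s
    rw [hg, ← mul_assoc, ← Real.exp_add]
    congr 2
    ring
  have hd1 : HasDerivAt (fun y : ℝ => κ * y) κ x := by
    simpa using (hasDerivAt_id x).const_mul κ
  have hd2 : HasDerivAt (fun y => G (y + p)) (g (x + p)) x := (hGd (x + p)).comp_add_const x p
  have hd := hd1.exp.mul (hd2.sub (hGd x))
  rw [e]
  refine hd.congr_deriv ?_
  have e1 : Real.exp (κ * x) * g (x + p) = Real.exp (-(κ * p)) * opH k q u x := by
    simp only [hg]
    rw [(h.Hper hu).2, ← mul_assoc, ← Real.exp_add]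
    congr 2
    ring
  have e2 : Real.exp (κ * x) * g x = opH k q u x := by
    simp only [hg]
    rw [← mul_assoc, ← Real.exp_add]
    simp
  simp only [Pi.sub_apply]
  linear_combination e1 - e2

end PData

theorem lip_subseq (U : ℕ → ℝ → ℝ) (L : ℝ) (hL : 0 ≤ L) (h01 : ∀ n x, U n x ∈ Icc (0:ℝ) 1)
    (hlip : ∀ n x y, |U n x - U n y| ≤ L * |x - y|) :
    ∃ (f : ℕ → ℕ) (u : ℝ → ℝ), StrictMono f ∧
      ∀ x, Tendsto (fun n => U (f n) x) atTop (𝓝 (u x)) := by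
  obtain ⟨b, f, hf, hb⟩ := CompactSpace.tendsto_subseq
    (X := ℚ → Icc (0:ℝ) 1) (fun n r => ⟨U n r, h01 n r⟩)
  have hr : ∀ r : ℚ, Tendsto (fun n => U (f n) r) atTop (𝓝 (b r : ℝ)) := by
    intro r
    have := (tendsto_pi_nhds.1 hb) r
    exact (continuous_subtype_val.tendsto _).comp this
  have hx : ∀ x : ℝ, ∃ l, Tendsto (fun n => U (f n) x) atTop (𝓝 l) := by
    intro x
    refine cauchySeq_tendsto_of_complete (Metric.cauchySeq_iff.2 fun ε hε => ?_)
    have hδ : 0 < ε / (3 * (L + 1)) := by positivity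
    obtain ⟨r, hr1, hr2⟩ := exists_rat_btwn (lt_add_of_pos_right x hδ)
    have hd : L * |x - r| < ε / 3 := by
      have h1 : |x - r| < ε / (3 * (L + 1)) := by
        rw [abs_sub_comm, abs_of_pos (by linarith)]
        linarith
      calc L * |x - r| ≤ (L + 1) * |x - r| := by gcongr; linarith
        _ < (L + 1) * (ε / (3 * (L + 1))) := by gcongr
        _ = ε / 3 := by field_simp
    obtain ⟨N, hN⟩ := Metric.cauchySeq_iff.1 (hr r).cauchySeq (ε / 3) (by positivity)
    refine ⟨N, fun m hm n hn => ?_⟩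
    have h1 := hN m hm n hn
    rw [Real.dist_eq] at h1 ⊢
    have h2 := hlip (f m) x r
    have h3 := hlip (f n) x r
    rw [abs_lt] at h1 ⊢
    rw [abs_le] at h2 h3
    constructor <;> linarith [h1.1, h1.2, h2.1, h2.2, h3.1, h3.2]
  choose u hu using hx
  exact ⟨f, u, hf, hu⟩

/-- Subsolutions. -/
def GoodSub (k : ℝ → ℝ) (q : ℝ → ℝ → ℝ) (c p κ : ℝ) (u : ℝ → ℝ) : Prop :=
  CPer p u ∧ (∀ x, 0 ≤ u x) ∧ (∃ x, 0 < u x) ∧ ∀ x, opN c p κ * u x ≤ opS k q p κ u x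

namespace PData

variable {k : ℝ → ℝ} {q : ℝ → ℝ → ℝ} {c p D : ℝ}

theorem good_start (h : PData k q c p D) : GoodSub k q c p (1 / (c * D)) (fun _ => 1) := by
  have hc := h.hc
  have hD := h.hD
  have hκ : 0 < 1 / (c * D) := by positivity
  refine ⟨⟨continuous_const, fun _ => rfl⟩, fun _ => zero_le_one, ⟨0, zero_lt_one⟩, fun x => ?_⟩
  refine le_trans (le_of_eq ?_) (h.S_one hκ x)
  unfold opN
  field_simp

theorem good_bound (h : PData k q c p D) {κ : ℝ} (hκ : 0 < κ) {u : ℝ → ℝ}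
    (hu : GoodSub k q c p κ u) : κ ≤ D / c := by
  obtain ⟨hu, h0, ⟨x1, hx1⟩, hs⟩ := hu
  obtain ⟨x0, -, hm⟩ := hu.exists_max h.hp
  have hpos : 0 < u x0 := hx1.trans_le (hm x1)
  have h1 := (hs x0).trans (h.S_le hu (M := u x0)
    (fun x => by beta_reduce; rw [abs_of_nonneg (h0 x)]; exact hm x) hκ x0)
  have hN := h.N_pos hκ
  have hc := h.hc
  unfold opN at h1 hN
  have hE : 0 < 1 - Real.exp (-(κ * p)) := pos_of_mul_pos_right hN hc.le
  set E := 1 - Real.exp (-(κ * p))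
  rw [le_div_iff₀ hc]
  have h2 : c * E * u x0 * κ ≤ E * (D * u x0) := by
    have := mul_le_mul_of_nonneg_right h1 hκ.le
    calc _ ≤ _ := this
      _ = _ := by field_simp
  have h3 : (κ * c) * (E * u x0) ≤ D * (E * u x0) := by linarith
  exact le_of_mul_le_mul_right h3 (by positivity)

/-- improved function -/
theorem good_improve (h : PData k q c p D) {κ : ℝ} (hκ : 0 < κ) {u : ℝ → ℝ}
    (hu : GoodSub k q c p κ u) :
    GoodSub k q c p κ (fun x => (opN c p κ)⁻¹ * opS k q p κ u x) ∧
      ∀ x, u x ≤ (opN c p κ)⁻¹ * opS k q p κ u x := by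
  obtain ⟨hu, h0, ⟨x1, hx1⟩, hs⟩ := hu
  have hN := h.N_pos hκ
  have hle : ∀ x, u x ≤ (opN c p κ)⁻¹ * opS k q p κ u x := fun x => by
    rw [inv_mul_eq_div, le_div_iff₀ hN, mul_comm]
    exact hs x
  have hSp := h.S_per hu κ
  have hw : CPer p (fun x => (opN c p κ)⁻¹ * opS k q p κ u x) :=
    ⟨continuous_const.mul hSp.1, fun x => by beta_reduce; rw [hSp.2]⟩
  refine ⟨⟨hw, fun x => (h0 x).trans (hle x), ⟨x1, hx1.trans_le (hle x1)⟩, fun x => ?_⟩, hle⟩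
  rw [mul_inv_cancel_left₀ hN.ne']
  exact h.S_mono hu hw hle κ x

theorem good_normalize (h : PData k q c p D) {κ : ℝ} (hκ : 0 < κ) {u : ℝ → ℝ}
    (hu : GoodSub k q c p κ u) :
    ∃ v, GoodSub k q c p κ v ∧ (∀ x, v x ∈ Icc (0:ℝ) 1) ∧ (∃ x0 ∈ Icc 0 p, v x0 = 1) ∧
      ∀ x y, |v x - v y| ≤ D / c * |x - y| := by
  obtain ⟨hw, hle⟩ := h.good_improve hκ hu
  have hκb := h.good_bound hκ hu
  obtain ⟨hu, h0, -, hs⟩ := hu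
  set w := fun x => (opN c p κ)⁻¹ * opS k q p κ u x with hwdef
  obtain ⟨hwp, hw0, ⟨x1, hx1⟩, hws⟩ := hw
  obtain ⟨x0, hx0, hm⟩ := hwp.exists_max h.hp
  have hM : 0 < w x0 := hx1.trans_le (hm x1)
  have hN := h.N_pos hκ
  have hc := h.hc
  have hD := h.hD
  have hwd : ∀ x, HasDerivAt w (κ * w x - opH k q u x / c) x := by
    intro x
    have := (h.S_deriv hu κ x).const_mul (opN c p κ)⁻¹
    refine this.congr_deriv ?_
    have hE : 1 - Real.exp (-(κ * p)) ≠ 0 := by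
      unfold opN at hN
      exact (pos_of_mul_pos_right hN hc.le).ne'
    simp only [hwdef, opN]
    field_simp
  have hub : ∀ x, |u x| ≤ w x0 := fun x => by
    rw [abs_of_nonneg (h0 x)]
    exact (hle x).trans (hm x)
  have hderiv : ∀ x, ‖deriv w x‖ ≤ D / c * w x0 := by
    intro x
    rw [(hwd x).deriv, Real.norm_eq_abs, abs_le]
    have a1 : 0 ≤ κ * w x := mul_nonneg hκ.le (hw0 x)
    have a2 : κ * w x ≤ D / c * w x0 := mul_le_mul hκb (hm x) (hw0 x) (by positivity)
    have a3 : 0 ≤ opH k q u x / c := div_nonneg (h.H_nonneg h0 x) hc.le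
    have a4 : opH k q u x / c ≤ D / c * w x0 := by
      have := h.H_le hu hub x
      calc _ ≤ (D * w x0) / c := by gcongr
        _ = _ := by ring
    constructor <;> linarith
  have hlip : ∀ x y, |w x - w y| ≤ D / c * w x0 * |x - y| := fun x y =>
    Convex.norm_image_sub_le_of_norm_deriv_le (s := univ)
      (fun z _ => (hwd z).differentiableAt) (fun z _ => hderiv z) convex_univ
      (mem_univ y) (mem_univ x)
  refine ⟨fun x => (w x0)⁻¹ * w x, ⟨⟨continuous_const.mul hwp.1, fun x => by beta_reduce; rw [hwp.2]⟩,
    fun x => mul_nonneg (inv_pos.2 hM).le (hw0 x), ⟨x1, mul_pos (inv_pos.2 hM) hx1⟩,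
    fun x => ?_⟩, fun x => ⟨mul_nonneg (inv_pos.2 hM).le (hw0 x), ?_⟩, ⟨x0, hx0, ?_⟩,
    fun x y => ?_⟩
  · beta_reduce
    rw [S_smul, mul_left_comm]
    exact mul_le_mul_of_nonneg_left (hws x) (inv_pos.2 hM).le
  · beta_reduce
    rw [inv_mul_eq_div, div_le_one hM]
    exact hm x
  · exact inv_mul_cancel₀ hM.ne'
  · beta_reduce
    rw [← mul_sub, abs_mul, abs_of_pos (inv_pos.2 hM), inv_mul_eq_div, div_le_iff₀ hM]
    linarith [hlip x y]

theorem good_limit (h : PData k q c p D) {K : ℕ → ℝ} {κ : ℝ} (hK : ∀ n, 0 < K n)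
    (hl : Tendsto K atTop (𝓝 κ)) (hg : ∀ n, ∃ u, GoodSub k q c p (K n) u) :
    ∃ u, GoodSub k q c p κ u := by
  have hg' := fun n => h.good_normalize (hK n) (hg n).choose_spec
  choose V hV h01 hX hlip using hg'
  choose X hXm hX1 using hX
  have hL : 0 ≤ D / c := div_nonneg h.hD.le h.hc.le
  obtain ⟨x, hx, f, hf, hfx⟩ := (isCompact_Icc (a := (0:ℝ)) (b := p)).tendsto_subseq hXm
  obtain ⟨g, u, hgm, hu⟩ := lip_subseq (fun n => V (f n)) (D / c) hL (fun n => h01 (f n))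
    (fun n => hlip (f n))
  have hfg : Tendsto (fun n => f (g n)) atTop atTop := hf.tendsto_atTop.comp hgm.tendsto_atTop
  have hulip : ∀ y z, |u y - u z| ≤ D / c * |y - z| := fun y z =>
    le_of_tendsto ((hu y).sub (hu z)).abs (Eventually.of_forall fun n => hlip (f (g n)) y z)
  have huc : Continuous u := by
    have : LipschitzWith (Real.toNNReal (D / c)) u := LipschitzWith.of_dist_le_mul fun y z => by
      rw [Real.dist_eq, Real.dist_eq, Real.coe_toNNReal _ hL]
      exact hulip y z
    exact this.continuous
  refine ⟨u, ⟨huc, fun y => ?_⟩, fun y => ?_, ⟨x, ?_⟩, fun y => ?_⟩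
  · refine tendsto_nhds_unique (hu (y + p)) ((hu y).congr fun n => ?_)
    exact ((hV (f (g n))).1.2 y).symm
  · exact ge_of_tendsto' (hu y) fun n => (h01 (f (g n)) y).1
  · have h1 : Tendsto (fun n => 1 - D / c * |X (f (g n)) - x|) atTop (𝓝 (1 - D / c * |x - x|)) :=
      (((hfx.comp hgm.tendsto_atTop).sub_const x).abs.const_mul _).const_sub _
    have h2 : (1 - D / c * |x - x|) ≤ u x := le_of_tendsto_of_tendsto' h1 (hu x) fun n => by
      have := hlip (f (g n)) (X (f (g n))) x
      rw [hX1] at this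
      linarith [(abs_le.1 this).2]
    simp only [sub_self, abs_zero, mul_zero, sub_zero] at h2
    linarith
  · have hKl := hl.comp hfg
    have h1 := h.S_tendsto (U := fun n => V (f (g n))) (K := fun n => K (f (g n)))
      (fun n => (hV _).1) (fun n y => by
        rw [abs_of_nonneg (h01 _ y).1]
        exact (h01 _ y).2) (fun n y => (h01 _ y).1) (fun n => (hK _).le) hKl hu y
    have hNc : Continuous (opN c p) := by
      unfold opN
      fun_prop
    have h2 := ((hNc.tendsto κ).comp hKl).mul (hu y)
    exact le_of_tendsto_of_tendsto' h2 h1 fun n => (hV (f (g n))).2.2.2 y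

theorem good_strict (h : PData k q c p D) {κ : ℝ} (hκ : 0 < κ) {u : ℝ → ℝ}
    (hu : GoodSub k q c p κ u) {x0 : ℝ} (hx0 : opN c p κ * u x0 < opS k q p κ u x0) :
    ∃ κ' > κ, ∃ w, GoodSub k q c p κ' w := by
  obtain ⟨hw, hle⟩ := h.good_improve hκ hu
  have hN := h.N_pos hκ
  set w := fun x => (opN c p κ)⁻¹ * opS k q p κ u x with hwdef
  have hlt : u x0 < w x0 := by
    simp only [hwdef]
    rw [inv_mul_eq_div, lt_div_iff₀ hN, mul_comm]
    exact hx0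
  obtain ⟨hwp, hw0, hw1, hws⟩ := hw
  have hd : CPer p (fun y => w y - u y) :=
    ⟨hwp.1.sub hu.1.1, fun x => by beta_reduce; rw [hwp.2, hu.1.2]⟩
  have hst : ∀ x, opN c p κ * w x < opS k q p κ w x := by
    intro x
    have h1 := h.S_pos hd (fun y => sub_nonneg.2 (hle y)) (x0 := x0) (sub_pos.2 hlt) κ x
    rw [h.S_sub hu.1 hwp] at h1
    have h2 : opN c p κ * w x = opS k q p κ u x := by
      simp only [hwdef]
      rw [mul_inv_cancel_left₀ hN.ne']
    linarith
  have hS := h.S_cont2 hwp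
  have hNc : Continuous (fun y : ℝ × ℝ => opN c p y.1 * w y.2) := by
    have := hwp.1
    unfold opN
    fun_prop
  have hev := (isCompact_Icc (a := (0:ℝ)) (b := p)).eventually_forall_of_forall_eventually
    (x₀ := κ) (P := fun κ' x => opN c p κ' * w x < opS k q p κ' w x)
    (fun x _ => (hNc.tendsto (κ, x)).eventually_lt (hS.tendsto (κ, x)) (hst x))
  have hev2 : ∀ᶠ κ' in 𝓝[>] κ, ∀ y ∈ Icc 0 p, opN c p κ' * w y < opS k q p κ' w y :=
    hev.filter_mono nhdsWithin_le_nhds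
  obtain ⟨κ', h1, h2⟩ := (hev2.and self_mem_nhdsWithin).exists
  refine ⟨κ', h2, w, hwp, hw0, hw1, fun x => ?_⟩
  have hP : Function.Periodic (fun x => opS k q p κ' w x - opN c p κ' * w x) p := fun y => by
    simp only [(h.S_per hwp κ').2, hwp.2]
  obtain ⟨y, hy, e⟩ := hP.exists_mem_Ico₀ h.hp x
  have := h1 y (Ico_subset_Icc_self hy)
  beta_reduce at e
  linarith

theorem exists_sol (h : PData k q c p D) :
    ∃ κ > 0, ∃ u : ℝ → ℝ, CPer p u ∧ (∀ x, 0 < u x) ∧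
      ∀ x, HasDerivAt u (κ * u x - opH k q u x / c) x := by
  have hc := h.hc
  have hD := h.hD
  set S : Set ℝ := {κ | 0 < κ ∧ ∃ u, GoodSub k q c p κ u} with hSdef
  have hne : (1 / (c * D)) ∈ S := ⟨by positivity, _, h.good_start⟩
  have hbd : BddAbove S := ⟨D / c, fun κ hκ => h.good_bound hκ.1 hκ.2.choose_spec⟩
  obtain ⟨K, -, hKl, hKS⟩ := exists_seq_tendsto_sSup ⟨_, hne⟩ hbd
  have hκ : 0 < sSup S := lt_of_lt_of_le (by positivity) (le_csSup hbd hne)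
  obtain ⟨u, hu⟩ := h.good_limit (fun n => (hKS n).1) hKl (fun n => (hKS n).2)
  set κ := sSup S
  have hN := h.N_pos hκ
  have heq : ∀ x, opN c p κ * u x = opS k q p κ u x := by
    intro x
    refine le_antisymm (hu.2.2.2 x) (not_lt.1 fun hlt => ?_)
    obtain ⟨κ', h1, w, hw⟩ := h.good_strict hκ hu hlt
    exact absurd (le_csSup hbd (show κ' ∈ S from ⟨hκ.trans h1, w, hw⟩)) (not_le.2 h1)
  obtain ⟨hup, h0, ⟨x1, hx1⟩, -⟩ := hu
  have hue : u = fun x => (opN c p κ)⁻¹ * opS k q p κ u x := by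
    ext x
    rw [← heq, inv_mul_cancel_left₀ hN.ne']
  refine ⟨κ, hκ, u, hup, fun x => ?_, fun x => ?_⟩
  · have := h.S_pos hup h0 hx1 κ x
    rw [← heq] at this
    exact pos_of_mul_pos_right this hN.le
  · have := (h.S_deriv hup κ x).const_mul (opN c p κ)⁻¹
    rw [← hue, ← heq] at this
    refine this.congr_deriv ?_
    have hE : 1 - Real.exp (-(κ * p)) ≠ 0 := by
      unfold opN at hN
      exact (pos_of_mul_pos_right hN hc.le).ne'
    simp only [opN]
    field_simp

end PData

/-- Existence of the principal eigenvalue in the periodic case. -/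
theorem principal_eigenvalue_periodic
    (k : ℝ → ℝ) (hk : H1 k)
    (c p : ℝ) (hc : 0 < c) (hp : 0 < p)
    (a : ℝ → ℝ) (ha : ∃ K : NNReal, LipschitzWith K a) (hap : ∀ ξ, a (ξ + p) = a ξ)
    (abar : ℝ) (habar : abar = (1 / p) * ∫ s in (0:ℝ)..p, a s) :
    ∃ lam : ℝ, ∃ φ : ℝ → ℝ, -1 + abar < lam ∧
      ContDiff ℝ 1 φ ∧ (∀ ξ, 0 < φ ξ) ∧ (∀ ξ, φ (ξ + p) = φ ξ) ∧
      ∀ ξ, c * deriv φ ξ + ((∫ η, k (η - ξ) * φ η) - φ ξ) + a ξ * φ ξ = lam * φ ξ := by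
  obtain ⟨hk1, hk0, -, hkI, hkp, -⟩ := hk
  obtain ⟨La, ha⟩ := ha
  have hac := ha.continuous
  have hki : Integrable k := by
    by_contra hn
    rw [integral_undef hn] at hkI
    exact zero_ne_one hkI
  set b : ℝ → ℝ := fun s => (a s - abar) / c with hb
  have hbc : Continuous b := by fun_prop
  set B : ℝ → ℝ := fun x => ∫ s in (0:ℝ)..x, b s with hB
  have hBd : ∀ x, HasDerivAt B (b x) x := fun x => (hbc.integral_hasStrictDerivAt 0 x).hasDerivAt
  have hBc : Continuous B := continuous_iff_continuousAt.2 fun x => (hBd x).continuousAt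
  have hbp : Function.Periodic b p := fun x => by simp only [hb, hap]
  have hBp0 : ∫ s in (0:ℝ)..p, b s = 0 := by
    simp only [hb]
    rw [intervalIntegral.integral_div, intervalIntegral.integral_sub (hac.intervalIntegrable _ _)
      (continuous_const.intervalIntegrable _ _), intervalIntegral.integral_const, habar]
    simp only [sub_zero, smul_eq_mul]
    field_simp
    simp
  have hBp : ∀ x, B (x + p) = B x := by
    intro x
    simp only [hB]
    rw [← intervalIntegral.integral_add_adjacent_intervals (hbc.intervalIntegrable 0 x)
      (hbc.intervalIntegrable x (x + p)), hbp.intervalIntegral_add_eq x 0, zero_add, hBp0, add_zero]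
  obtain ⟨M, hM0, hM⟩ := CPer.bdd (p := p) (u := B) ⟨hBc, hBp⟩ hp
  have hP : PData k (fun x y => Real.exp (B x - B y)) c p (Real.exp (2 * M)) :=
    { kc := hk1.continuous
      k0 := hk0
      ki := hki
      k1 := hkI
      kp := hkp
      qc := by
        simp only [Function.uncurry_def]
        fun_prop
      ql := fun x y => by
        rw [one_div, ← Real.exp_neg]
        have h1 := abs_le.1 (hM x)
        have h2 := abs_le.1 (hM y)
        exact Real.exp_le_exp.2 (by linarith [h1.1, h1.2, h2.1, h2.2])
      qu := fun x y => by
        have h1 := abs_le.1 (hM x)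
        have h2 := abs_le.1 (hM y)
        exact Real.exp_le_exp.2 (by linarith [h1.1, h1.2, h2.1, h2.2])
      qp := fun x y => by simp only [hBp]
      hc := hc
      hp := hp
      hD := Real.exp_pos _ }
  obtain ⟨κ, hκ, u, hu, hu0, hud⟩ := hP.exists_sol
  set q : ℝ → ℝ → ℝ := fun x y => Real.exp (B x - B y) with hq
  have hφd : ∀ x, HasDerivAt (fun x => Real.exp (-B x) * u x)
      (Real.exp (-B x) * -b x * u x + Real.exp (-B x) * (κ * u x - opH k q u x / c)) x :=
    fun x => ((hBd x).neg.exp).mul (hud x)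
  have hI : ∀ x, ∫ η, k (η - x) * (Real.exp (-B η) * u η) = Real.exp (-B x) * opH k q u x := by
    intro x
    rw [← integral_add_right_eq_self (fun η => k (η - x) * (Real.exp (-B η) * u η)) x]
    unfold opH
    rw [← integral_const_mul]
    congr 1
    ext z
    rw [add_sub_cancel_right, add_comm z x]
    simp only [hq]
    rw [show Real.exp (-B (x + z)) = Real.exp (-B x) * Real.exp (B x - B (x + z)) by
      rw [← Real.exp_add]
      congr 1
      ring]
    ring
  refine ⟨c * κ - 1 + abar, fun x => Real.exp (-B x) * u x, ?_, ?_,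
    fun x => mul_pos (Real.exp_pos _) (hu0 x), fun x => by simp only [hBp, hu.2], fun x => ?_⟩
  · have := mul_pos hc hκ
    linarith
  · rw [contDiff_one_iff_deriv]
    refine ⟨fun x => (hφd x).differentiableAt, ?_⟩
    rw [show deriv (fun x => Real.exp (-B x) * u x) = _ from funext fun x => (hφd x).deriv]
    have h1 := (hP.Hper hu).1
    have h2 := hu.1
    fun_prop
  · rw [(hφd x).deriv, hI x]
    simp only [hb]
    field_simp
    ring
end
end
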